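/- arXiv:2401.10069 — 6 statements merged into one kernel-verified Lean document; each statement's English description precedes it below -/
import Mathlib

section
/- Let (Δ; Ω, ≤) be a b-homological system over R and ⪯ a fixed linear order on Ω/∼ extending the induced partial order. Let 0 = W_{u_{a+1}} ⊊ W_{u_a} ⊊ ⋯ ⊊ W_{u_1} = M and 0 = W'_{u'_{b+1}} ⊊ W'_{u'_b} ⊊ ⋯ ⊊ W'_{u'_1} = N be ordered Δ̃-filtrations of left R-modules M and N, and let f : W_{u_a} → N be an R-module homomorphism. Then: (i) if u'_b ≺ u_a then f = 0; and (ii) if f ≠ 0, then Im f ⊆ W'_{u'_c}, where u'_c is the ⪯-least element of {u'_1, u'_2, …, u'_b} satisfying u_a ⪯ u'_c. -/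
open CategoryTheory DirectSum

universe u v w

/-- The first `Ext` group of two `R`-modules, used to state axiom HS4. -/
noncomputable abbrev ext1Grp (R : Type u) [Ring R] (A B : ModuleCat.{u} R) : ModuleCat ℤ :=
  ((Ext ℤ (ModuleCat.{u} R) 1).obj (Opposite.op A)).obj B

/-- A b-homological system `(Δ; Ω, ≤)` over the ring `R`: a preordered set `Ω` together with a
family of pairwise non-isomorphic finitely generated `R`-modules with local endomorphism rings,
satisfying the axioms HS3 and HS4. -/
structure BHomSystem (R : Type u) [Ring R] (Ω : Type u) [Preorder Ω] : Type (u + 1) where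
  Δ : Ω → ModuleCat.{u} R
  fg : ∀ ω, Module.Finite R (Δ ω)
  localEnd : ∀ ω, IsLocalRing (Module.End R (Δ ω))
  pairwiseNonIso : ∀ ⦃ω ω' : Ω⦄, ω ≠ ω' → IsEmpty ((Δ ω) ≃ₗ[R] (Δ ω'))
  hs3 : ∀ ⦃ω ω' : Ω⦄, (∃ f : (Δ ω) →ₗ[R] (Δ ω'), f ≠ 0) → ω ≤ ω'
  hs4 : ∀ ⦃ω ω' : Ω⦄, Nontrivial (ext1Grp R (Δ ω) (Δ ω')) → ω ≤ ω' ∧ ¬ ω' ≤ ω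

/-- The class `[ω]` of `ω` in the antisymmetrization `Ω/∼` of the preorder on `Ω`. -/
abbrev ordCls {Ω : Type u} [Preorder Ω] (ω : Ω) : Antisymmetrization Ω (· ≤ ·) :=
  toAntisymmetrization (α := Ω) (· ≤ ·) ω

variable {R : Type u} [Ring R] {Ω : Type u} [Preorder Ω]

/-- An ordered `Δ̃`-filtration of `M` with respect to a linear order `r` on `Ω/∼`: a strictly
decreasing chain `M = W_{u_1} ⊋ W_{u_2} ⊋ ⋯ ⊋ W_{u_a} ⊋ 0` indexed by `r`-increasing elements
`u_1 ≺ ⋯ ≺ u_a` of `Ω/∼` (here `W s.castSucc` is `W_{u_{s+1}}` for `s : Fin a`, and `W (last a)`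
is the tag `W_{u_{a+1}} = 0`), such that each quotient `W_{u_s}/W_{u_{s+1}}` is isomorphic to
`⨁_{[ω] = u_s} Δ_ω^(I_ω)` with finitely many index sets nonempty and at least one nonempty. -/
structure BHomSystem.OrderedFiltration (S : BHomSystem R Ω)
    (r : Antisymmetrization Ω (· ≤ ·) → Antisymmetrization Ω (· ≤ ·) → Prop)
    (M : Type u) [AddCommGroup M] [Module R M] : Type (max u (w + 1)) where
  a : ℕ
  u : Fin a → Antisymmetrization Ω (· ≤ ·)
  uStrictMono : ∀ ⦃i j : Fin a⦄, i < j → r (u i) (u j) ∧ u i ≠ u j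
  W : Fin (a + 1) → Submodule R M
  strictAnti : StrictAnti W
  top : W 0 = ⊤
  bot : W (Fin.last a) = ⊥
  idx : Fin a → Ω → Type w
  finSupp : ∀ s, {ω : Ω | Nonempty (idx s ω)}.Finite
  nonzero : ∀ s : Fin a, ∃ ω : Ω, ordCls ω = u s ∧ Nonempty (idx s ω)
  iso : ∀ s : Fin a,
    Nonempty ((↥(W s.castSucc) ⧸ (Submodule.comap (W s.castSucc).subtype (W s.succ))) ≃ₗ[R]
      (⨁ ω : {ω : Ω // ordCls ω = u s}, (idx s ω.1 →₀ S.Δ ω.1)))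

theorem aux_dsum_hom_zero (S : BHomSystem R Ω)
    (r : Antisymmetrization Ω (· ≤ ·) → Antisymmetrization Ω (· ≤ ·) → Prop)
    (hext : ∀ x y : Antisymmetrization Ω (· ≤ ·), x ≤ y → r x y)
    (x y : Antisymmetrization Ω (· ≤ ·)) (I J : Ω → Type w) (hxy : ¬ r x y)
    (g : (⨁ ω : {ω : Ω // ordCls ω = x}, (I ω.1 →₀ S.Δ ω.1)) →ₗ[R]
      (⨁ ω : {ω : Ω // ordCls ω = y}, (J ω.1 →₀ S.Δ ω.1))) : g = 0 := by
  classical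
  apply DirectSum.linearMap_ext
  intro ω
  apply Finsupp.lhom_ext'
  intro i
  apply LinearMap.ext
  intro m
  refine DFinsupp.ext fun ω' => Finsupp.ext fun j => ?_
  by_contra hne
  let h : S.Δ ω.1 →ₗ[R] S.Δ ω'.1 :=
    (Finsupp.lapply j) ∘ₗ (DirectSum.component R _ _ ω') ∘ₗ g ∘ₗ
      (DirectSum.lof R _ _ ω) ∘ₗ (Finsupp.lsingle i)
  have hh : h ≠ 0 := fun h0 => hne (by
    have := LinearMap.congr_fun h0 m
    exact this)
  have hle := S.hs3 ⟨h, hh⟩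
  apply hxy
  have := hext (ordCls ω.1) (ordCls ω'.1) hle
  rwa [ω.2, ω'.2] at this

theorem aux_step (S : BHomSystem R Ω)
    (r : Antisymmetrization Ω (· ≤ ·) → Antisymmetrization Ω (· ≤ ·) → Prop)
    (hext : ∀ x y : Antisymmetrization Ω (· ≤ ·), x ≤ y → r x y)
    (N : Type u) [AddCommGroup N] [Module R N]
    (G : BHomSystem.OrderedFiltration.{u, w} S r N)
    (A : Type u) [AddCommGroup A] [Module R A]
    (x : Antisymmetrization Ω (· ≤ ·)) (I : Ω → Type w)
    (e : A ≃ₗ[R] (⨁ ω : {ω : Ω // ordCls ω = x}, (I ω.1 →₀ S.Δ ω.1)))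
    (f : A →ₗ[R] N) (s : Fin G.a) (hs : ¬ r x (G.u s))
    (hf : LinearMap.range f ≤ G.W s.castSucc) : LinearMap.range f ≤ G.W s.succ := by
  obtain ⟨e'⟩ := G.iso s
  let f' : A →ₗ[R] G.W s.castSucc := f.codRestrict _ (fun a => hf ⟨a, rfl⟩)
  have h0 := aux_dsum_hom_zero S r hext x (G.u s) I (G.idx s) hs
    (e'.toLinearMap ∘ₗ (Submodule.mkQ _) ∘ₗ f' ∘ₗ e.symm.toLinearMap)
  rintro _ ⟨a, rfl⟩
  have h1 := LinearMap.congr_fun h0 (e a)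
  simp only [LinearMap.comp_apply, LinearEquiv.coe_coe, LinearEquiv.symm_apply_apply,
    LinearMap.zero_apply, LinearEquiv.map_eq_zero_iff, Submodule.mkQ_apply,
    Submodule.Quotient.mk_eq_zero, Submodule.mem_comap] at h1
  exact h1

theorem aux_iter (S : BHomSystem R Ω)
    (r : Antisymmetrization Ω (· ≤ ·) → Antisymmetrization Ω (· ≤ ·) → Prop)
    (hext : ∀ x y : Antisymmetrization Ω (· ≤ ·), x ≤ y → r x y)
    (N : Type u) [AddCommGroup N] [Module R N]
    (G : BHomSystem.OrderedFiltration.{u, w} S r N)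
    (A : Type u) [AddCommGroup A] [Module R A]
    (x : Antisymmetrization Ω (· ≤ ·)) (I : Ω → Type w)
    (e : A ≃ₗ[R] (⨁ ω : {ω : Ω // ordCls ω = x}, (I ω.1 →₀ S.Δ ω.1)))
    (f : A →ₗ[R] N) (k : ℕ) (hk : k < G.a + 1)
    (hs : ∀ s : Fin G.a, s.1 < k → ¬ r x (G.u s)) : LinearMap.range f ≤ G.W ⟨k, hk⟩ := by
  induction k with
  | zero => exact le_top.trans_eq G.top.symm
  | succ k ih =>
    exact aux_step S r hext N G A x I e f ⟨k, by omega⟩ (hs _ (Nat.lt_succ_self k))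
      (ih (by omega) fun s h => hs s (by omega))

/-- Morphisms out of the bottom layer `W_{u_a}` of an ordered `Δ̃`-filtration: if `u'_b ≺ u_a`
then `f = 0`, and if `f ≠ 0` then `Im f ⊆ W'_{u'_c}` for `u'_c` the `⪯`-least element among
`u'_1, …, u'_b` with `u_a ⪯ u'_c`. -/
theorem image_of_bottom_layer (S : BHomSystem R Ω)
    (r : Antisymmetrization Ω (· ≤ ·) → Antisymmetrization Ω (· ≤ ·) → Prop)
    (hr : IsLinearOrder (Antisymmetrization Ω (· ≤ ·)) r)
    (hext : ∀ x y : Antisymmetrization Ω (· ≤ ·), x ≤ y → r x y)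
    (M N : Type u) [AddCommGroup M] [Module R M] [AddCommGroup N] [Module R N]
    (F : BHomSystem.OrderedFiltration.{u, w} S r M)
    (G : BHomSystem.OrderedFiltration.{u, w} S r N)
    (ha : 0 < F.a) (hb : 0 < G.a)
    (f : ↥(F.W ⟨F.a - 1, by omega⟩) →ₗ[R] N) :
    ((r (G.u ⟨G.a - 1, by omega⟩) (F.u ⟨F.a - 1, by omega⟩) ∧
        G.u ⟨G.a - 1, by omega⟩ ≠ F.u ⟨F.a - 1, by omega⟩) → f = 0) ∧
    (f ≠ 0 → ∃ c : Fin G.a,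
      r (F.u ⟨F.a - 1, by omega⟩) (G.u c) ∧
      (∀ c' : Fin G.a, r (F.u ⟨F.a - 1, by omega⟩) (G.u c') → r (G.u c) (G.u c')) ∧
      LinearMap.range f ≤ G.W c.castSucc) := by
  have key : ∃ I : Ω → Type w, Nonempty (↥(F.W ⟨F.a - 1, by omega⟩) ≃ₗ[R]
      (⨁ ω : {ω : Ω // ordCls ω = F.u ⟨F.a - 1, by omega⟩}, (I ω.1 →₀ S.Δ ω.1))) := by
    obtain ⟨e⟩ := F.iso ⟨F.a - 1, by omega⟩
    have hl : F.W (Fin.succ ⟨F.a - 1, by omega⟩) = ⊥ := by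
      rw [← F.bot]
      congr 1
      apply Fin.ext
      simp
      omega
    refine ⟨F.idx ⟨F.a - 1, by omega⟩, ⟨(Submodule.quotEquivOfEqBot _ ?_).symm.trans e⟩⟩
    rw [hl]
    exact LinearMap.ker_eq_bot.2 (Submodule.subtype_injective _)
  obtain ⟨I, ⟨e⟩⟩ := key
  have iter := aux_iter S r hext N G _ _ I e f
  have none : (∀ s : Fin G.a, ¬ r (F.u ⟨F.a - 1, by omega⟩) (G.u s)) → f = 0 := by
    intro h
    have := iter G.a (by omega) (fun s _ => h s)
    rw [← LinearMap.range_eq_bot]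
    exact le_bot_iff.1 (this.trans_eq G.bot)
  have mono : ∀ i j : Fin G.a, i ≤ j → r (G.u i) (G.u j) := by
    intro i j hij
    rcases hij.eq_or_lt with h | h
    · subst h
      exact hr.refl _
    · exact (G.uStrictMono h).1
  constructor
  · rintro ⟨h1, h2⟩
    apply none
    intro s hs
    have h3 := mono s ⟨G.a - 1, by omega⟩ (by
      rw [Fin.le_def]
      have := s.2
      simp
      omega)
    exact h2 (hr.antisymm _ _ h1 (hr.trans _ _ _ hs h3))
  · intro hf
    classical
    have hex : ∃ k : ℕ, ∃ hk : k < G.a, r (F.u ⟨F.a - 1, by omega⟩) (G.u ⟨k, hk⟩) := by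
      by_contra hcon
      exact hf (none fun s hs => hcon ⟨s.1, s.2, hs⟩)
    obtain ⟨hk, hc⟩ := Nat.find_spec hex
    refine ⟨⟨Nat.find hex, hk⟩, hc, fun c' h' => ?_, ?_⟩
    · exact mono _ _ (Fin.le_def.2 (Nat.find_min' hex ⟨c'.2, h'⟩))
    · exact iter (Nat.find hex) (by omega) (fun s hs h => Nat.find_min hex hs ⟨s.2, h⟩)
end

section
/- Let R be a ring and M = ⊕_{i ∈ I} G_i a left R-module, where each G_i is finitely generated and has a local endomorphism ring. Assume M = L ⊕ N is an internal direct sum of submodules. Then there exist direct sum decompositions L = ⊕_{j ∈ I'} L_j and N = ⊕_{t ∈ I''} N_t such that: (1) for every j ∈ I' there exists i_j ∈ I with L_j ≅ G_{i_j}; (2) for every t ∈ I'' there exists i_t ∈ I with N_t ≅ G_{i_t}; and (3) for every left R-module G with local endomorphism ring, the cardinality of {i ∈ I : G_i ≅ G} equals the cardinality of {j ∈ I' : L_j ≅ G} plus the cardinality of {t ∈ I'' : N_t ≅ G}. -/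
open CategoryTheory DirectSum

universe u v w

theorem aux_ring {E J : Type*} [Ring E] [Fintype J] (e : J → E) (he : ∑ j, e j = 1)
    (hid : ∀ j, e j * e j = e j)
    (hloc : ∀ j a, (∃ b, b * (e j * a * e j) = e j) ∨ (∃ b, b * (e j - e j * a * e j) = e j))
    (f : E) : (∃ u, u * f = 1) ∨ ∃ j g, e j * g * (1 - f) * e j = e j := by
  by_cases hf : Ideal.span {f} = (⊤ : Ideal E)
  · left
    have : (1 : E) ∈ Ideal.span {f} := by rw [hf]; trivial
    obtain ⟨u, hu⟩ := Ideal.mem_span_singleton'.1 this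
    exact ⟨u, hu⟩
  right
  obtain ⟨m, hm, hfm⟩ := Ideal.exists_le_maximal _ hf
  have hfm : f ∈ m := hfm (Ideal.subset_span rfl)
  have h1 : ∃ j, (1 - f) * e j ∉ m := by
    by_contra! h
    have h2 : (1 - f) ∈ m := by
      have : (1 - f) = ∑ j, (1 - f) * e j := by rw [← Finset.mul_sum, he, mul_one]
      rw [this]
      exact Ideal.sum_mem _ fun j _ => h j
    apply hm.ne_top
    rw [Ideal.eq_top_iff_one]
    simpa using m.add_mem h2 hfm
  obtain ⟨j, hj⟩ := h1
  have h3 : e j ∈ m ⊔ Ideal.span {(1 - f) * e j} := by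
    have : m ⊔ Ideal.span {(1 - f) * e j} = ⊤ := by
      apply hm.1.2
      refine lt_of_le_of_ne le_sup_left fun h => hj ?_
      rw [h]
      exact (le_sup_right : _ ≤ m ⊔ _) (Ideal.subset_span rfl)
    rw [this]; trivial
  obtain ⟨μ, hμ, y, hy, hμy⟩ := Submodule.mem_sup.1 h3
  obtain ⟨g, rfl⟩ := Ideal.mem_span_singleton'.1 hy
  rcases hloc j (g * (1 - f)) with ⟨b, hb⟩ | ⟨b, hb⟩
  · refine ⟨j, b * e j * g, ?_⟩
    calc _ = e j * (b * (e j * (g * (1 - f)) * e j)) := by simp only [mul_assoc]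
      _ = _ := by rw [hb, hid]
  · exfalso
    have h4 : e j - e j * (g * (1 - f)) * e j ∈ m := by
      have : e j - e j * (g * (1 - f)) * e j = e j * μ := by
        have : μ = e j - g * ((1 - f) * e j) := eq_sub_of_add_eq hμy
        rw [this, mul_sub (e j) (e j), hid]; simp only [mul_assoc]
      rw [this]
      exact m.mul_mem_left _ hμ
    have h5 := m.mul_mem_left b h4
    rw [hb] at h5
    exact hj (m.mul_mem_left _ h5)

theorem aux_end {R : Type*} [Ring R] {J : Type*} [Fintype J] [DecidableEq J] (A : J → Type*)
    [∀ j, AddCommGroup (A j)] [∀ j, Module R (A j)] (hA : ∀ j, IsLocalRing (Module.End R (A j)))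
    (f : Module.End R (∀ j, A j)) :
    (∃ u : Module.End R (∀ j, A j), u ∘ₗ f = LinearMap.id) ∨
    ∃ (j : J) (h : (∀ j, A j) →ₗ[R] A j), h ∘ₗ LinearMap.single R A j = LinearMap.id ∧
      ∀ y, f y = y → h y = 0 := by
  let e : J → Module.End R (∀ j, A j) := fun j => LinearMap.single R A j ∘ₗ LinearMap.proj j
  have hps : ∀ j x, (LinearMap.single R A j x) j = x := fun j x => by simp
  have H1 : ∑ j, e j = 1 := by
    refine LinearMap.ext fun x => ?_
    ext i
    simp [e, LinearMap.sum_apply]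
  have H2 : ∀ j, e j * e j = e j := by
    intro j
    refine LinearMap.ext fun x => ?_
    simp [e]
  have H3 : ∀ j a, (∃ b, b * (e j * a * e j) = e j) ∨ (∃ b, b * (e j - e j * a * e j) = e j) := by
    intro j a
    let c : Module.End R (A j) := LinearMap.proj j ∘ₗ a ∘ₗ LinearMap.single R A j
    rcases (hA j).isUnit_or_isUnit_of_add_one (show c + (1 - c) = 1 by abel) with hc | hc
    · left
      obtain ⟨d, hd⟩ := hc.exists_left_inv
      refine ⟨LinearMap.single R A j ∘ₗ d ∘ₗ LinearMap.proj j, LinearMap.ext fun x => ?_⟩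
      have := LinearMap.congr_fun hd (x j)
      simp [c] at this
      simp [e, this]
    · right
      obtain ⟨d, hd⟩ := hc.exists_left_inv
      refine ⟨LinearMap.single R A j ∘ₗ d ∘ₗ LinearMap.proj j, LinearMap.ext fun x => ?_⟩
      have := LinearMap.congr_fun hd (x j)
      simp [c] at this
      simp [e, this]
  rcases aux_ring e H1 H2 H3 f with ⟨u, hu⟩ | ⟨j, g, hg⟩
  · exact Or.inl ⟨u, hu⟩
  · right
    refine ⟨j, LinearMap.proj j ∘ₗ g ∘ₗ (LinearMap.id - f), ?_, ?_⟩
    · ext x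
      have := congrFun (LinearMap.congr_fun hg (LinearMap.single R A j x)) j
      simpa [e] using this
    · intro y hy
      simp [hy]

theorem aux_fin {R : Type*} [Ring R] {I : Type w} (G : I → Type*)
    [∀ j, AddCommGroup (G j)] [∀ j, Module R (G j)] (hG : ∀ j, IsLocalRing (Module.End R (G j)))
    {M : Type*} [AddCommGroup M] [Module R M] (p : Module.End R M) (x : M) (hx : p x = x) (n : ℕ) :
    ∀ (J : Type w) [Fintype J] (_ : Fintype.card J = n) (k : J → I) (ι : (∀ j, G (k j)) →ₗ[R] M)
      (π : M →ₗ[R] (∀ j, G (k j))) (_ : π ∘ₗ ι = LinearMap.id) (_ : x ∈ LinearMap.range ι),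
    ∃ (J : Type w) (_ : Fintype J) (k : J → I) (ι : (∀ j, G (k j)) →ₗ[R] M)
      (π : M →ₗ[R] (∀ j, G (k j))), π ∘ₗ ι = LinearMap.id ∧ x ∈ LinearMap.range ι ∧
        LinearMap.range ι ≤ LinearMap.range p := by
  classical
  induction n with
  | zero =>
    intro J _ hJ k ι π h hxι
    refine ⟨J, inferInstance, k, ι, π, h, hxι, ?_⟩
    rintro _ ⟨y, rfl⟩
    have := Fintype.card_eq_zero_iff.1 hJ
    have : y = 0 := Subsingleton.elim _ _
    simp [this]
  | succ n ih =>
    intro J _ hJ k ι π h hxι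
    obtain ⟨y, hy⟩ := hxι
    have hπι : ∀ z, π (ι z) = z := fun z => LinearMap.congr_fun h z
    rcases aux_end (fun j => G (k j)) (fun j => hG (k j)) (π ∘ₗ p ∘ₗ ι) with ⟨u, hu⟩ | ⟨j, g, hg, hg'⟩
    · refine ⟨J, inferInstance, k, p ∘ₗ ι, u ∘ₗ π, by rw [← hu]; rfl, ⟨y, by simp [hy, hx]⟩, ?_⟩
      rintro _ ⟨z, rfl⟩
      exact ⟨_, rfl⟩
    · have hgy := hg' y (by simp [hy, hx]; rw [← hy, hπι])
      have hgs : ∀ a, g (Pi.single j a) = a := fun a => LinearMap.congr_fun hg a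
      let ext0 : (∀ i : {i // i ≠ j}, G (k i)) →ₗ[R] (∀ i, G (k i)) :=
        LinearMap.pi fun i => if hi : i = j then 0 else LinearMap.proj (⟨i, hi⟩ : {i // i ≠ j})
      let r : (∀ i, G (k i)) →ₗ[R] (∀ i : {i // i ≠ j}, G (k i)) :=
        LinearMap.pi fun i => LinearMap.proj i.1
      let q : (∀ i : {i // i ≠ j}, G (k i)) →ₗ[R] (∀ i, G (k i)) :=
        ext0 - LinearMap.single R (fun i => G (k i)) j ∘ₗ g ∘ₗ ext0
      refine ih {i // i ≠ j} (by simp [Fintype.card_subtype_compl, hJ]) (fun i => k i) (ι ∘ₗ q) (r ∘ₗ π) ?_ ?_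
      · refine LinearMap.ext fun z => ?_
        ext i
        simp [hπι, r, q, ext0, i.2]
      · refine ⟨r y, ?_⟩
        rw [← hy]
        have h1 : ext0 (r y) = y - Pi.single j (y j) := by
          ext i
          by_cases hi : i = j
          · subst hi; simp [ext0]
          · simp [ext0, r, hi]
        have : q (r y) = y := by
          simp [q, h1, hgy, hgs, Pi.single_neg]
        simp [this]

theorem aux_idem {R : Type*} [Ring R] {I : Type w} (G : I → Type*)
    [∀ j, AddCommGroup (G j)] [∀ j, Module R (G j)] (hG : ∀ j, IsLocalRing (Module.End R (G j)))
    (p : Module.End R (Π₀ i, G i)) (hp : p * p = p) (x : Π₀ i, G i) :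
    ∃ a : Module.End R (Π₀ i, G i), a * a = a ∧ p * a = a ∧ a * p = a ∧ a (p x) = p x ∧
      ∃ (J : Type w) (k : J → I), Nonempty (LinearMap.range a ≃ₗ[R] Π₀ j, G (k j)) := by
  classical
  have hpp : ∀ z, p (p z) = p z := fun z => LinearMap.congr_fun hp z
  obtain ⟨J, _, k, ι, π, h1, ⟨y, hy⟩, h3⟩ := aux_fin G hG p (p x) (hpp x) _
    (((p x).support : Set I) : Type w) rfl (fun i => i.1) (DFinsupp.lmk (p x).support)
    (LinearMap.pi fun i => DFinsupp.lapply i.1) (by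
      refine LinearMap.ext fun z => ?_
      ext i
      have := i.2
      simp only [Finset.mem_coe] at this
      change (DFinsupp.mk (p x).support z) i.1 = z i
      rw [DFinsupp.mk_apply]
      exact dif_pos this) ⟨fun i => p x i, by
        ext i
        change (DFinsupp.mk (p x).support fun i => p x i) i = p x i
        rw [DFinsupp.mk_apply]
        split_ifs with h
        · rfl
        · simpa using (Eq.symm (by simpa using h))⟩
  have hπι : ∀ z, π (ι z) = z := fun z => LinearMap.congr_fun h1 z
  have hpι : ∀ z, p (ι z) = ι z := fun z => by
    obtain ⟨w, hw⟩ := h3 ⟨z, rfl⟩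
    rw [← hw, hpp]
  refine ⟨ι ∘ₗ π ∘ₗ p, ?_, ?_, ?_, ?_, J, k, ⟨?_⟩⟩
  · refine LinearMap.ext fun z => ?_
    simp [hπι, hpι]
  · refine LinearMap.ext fun z => ?_
    simp [hpι]
  · refine LinearMap.ext fun z => ?_
    simp [hpp]
  · simp [← hy]
    simp [hpι, hπι]
  · have : LinearMap.range (ι ∘ₗ π ∘ₗ p) = LinearMap.range ι := by
      apply le_antisymm
      · rintro _ ⟨z, rfl⟩; exact ⟨_, rfl⟩
      · rintro _ ⟨z, rfl⟩; exact ⟨ι z, by simp [hpι, hπι]⟩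
    exact (LinearEquiv.ofEq _ _ this).trans ((LinearEquiv.ofInjective ι
      (Function.LeftInverse.injective hπι)).symm.trans DFinsupp.linearEquivFunOnFintype.symm)

theorem aux_order {R : Type*} [Ring R] {M : Type*} [AddCommGroup M] [Module R M]
    {T : Type*} [LinearOrder T] (C : T → Submodule R M) (c : T → Module.End R M)
    (h1 : ∀ i, ∀ x ∈ C i, c i x = x) (h2 : ∀ i k, k < i → ∀ x ∈ C k, c i x = 0) :
    Nonempty ((Π₀ i, C i) ≃ₗ[R] ↥(⨆ i, C i)) := by
  classical
  have hinj : Function.Injective (DFinsupp.lsum ℕ fun i => (C i).subtype) := by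
    rw [← LinearMap.ker_eq_bot, LinearMap.ker_eq_bot']
    intro m hm
    by_contra hne
    have hs : m.support.Nonempty := by
      rwa [Finset.nonempty_iff_ne_empty, Ne, DFinsupp.support_eq_empty]
    set i := m.support.max' hs with hi
    have him : i ∈ m.support := Finset.max'_mem _ _
    have h3 : (DFinsupp.lsum ℕ fun i => (C i).subtype) m = ∑ j ∈ m.support, (m j : M) := by
      rw [DFinsupp.lsum_apply_apply, DFinsupp.sumAddHom_apply]
      rfl
    rw [h3] at hm
    have h4 := congrArg (c i) hm
    rw [map_sum, map_zero, Finset.sum_eq_single_of_mem i him, h1 i _ (m i).2] at h4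
    · simp only [DFinsupp.mem_support_iff] at him
      exact him (by simpa using h4)
    · intro b hb hbi
      exact h2 i b (lt_of_le_of_ne (Finset.le_max' _ _ hb) hbi) _ (m b).2
  exact ⟨(LinearEquiv.ofInjective _ hinj).trans
    (LinearEquiv.ofEq _ _ (Submodule.iSup_eq_range_dfinsupp_lsum C).symm)⟩

/-- iterated decomposition -/
theorem aux_sigma {R : Type*} [Ring R] {I T : Type w} (G : I → Type*)
    [∀ j, AddCommGroup (G j)] [∀ j, Module R (G j)] (C : T → Type*)
    [∀ j, AddCommGroup (C j)] [∀ j, Module R (C j)]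
    (h : ∀ t, ∃ (J : Type w) (k : J → I), Nonempty (C t ≃ₗ[R] Π₀ j, G (k j))) :
    ∃ (J : Type w) (k : J → I), Nonempty ((Π₀ t, C t) ≃ₗ[R] Π₀ j, G (k j)) := by
  classical
  choose J k e using h
  refine ⟨Σ t, J t, fun x => k x.1 x.2, ⟨?_⟩⟩
  exact (DFinsupp.mapRange.linearEquiv fun t => (e t).some).trans
    (DFinsupp.sigmaCurryLEquiv (M := fun t j => G (k t j))).symm

theorem aux_countable {R : Type*} [Ring R] {I : Type w} (G : I → Type*)
    [∀ j, AddCommGroup (G j)] [∀ j, Module R (G j)] (hG : ∀ j, IsLocalRing (Module.End R (G j)))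
    (c : Module.End R (Π₀ i, G i)) (hc : c * c = c) (x : ℕ → Π₀ i, G i)
    (hx : LinearMap.range c = Submodule.span R (Set.range x)) :
    ∃ (J : Type w) (k : J → I), Nonempty (LinearMap.range c ≃ₗ[R] Π₀ j, G (k j)) := by
  classical
  let E := Module.End R (Π₀ i, G i)
  choose! a ha1 ha2 ha3 ha4 ha5 using fun (p : E) (hp : p * p = p) (x : Π₀ i, G i) =>
    aux_idem G hG p hp x
  let P : ℕ → E := fun n => Nat.rec c (fun n p => p - a p (x n)) n
  have hP0 : P 0 = c := rfl
  have hPs : ∀ n, P (n + 1) = P n - a (P n) (x n) := fun n => rfl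
  have hP : ∀ n, P n * P n = P n := by
    intro n
    induction n with
    | zero => exact hc
    | succ n ih =>
      rw [hPs, sub_mul, mul_sub, mul_sub, ih, ha1 _ ih, ha2 _ ih, ha3 _ ih, sub_self, sub_zero]
  let b : ℕ → E := fun n => a (P n) (x n)
  have hb1 : ∀ n, b n * b n = b n := fun n => ha1 _ (hP n) _
  have hb2 : ∀ n, P n * b n = b n := fun n => ha2 _ (hP n) _
  have hb3 : ∀ n, b n * P n = b n := fun n => ha3 _ (hP n) _
  have hPs : ∀ n, P (n + 1) = P n - b n := fun n => rfl
  have hPb : ∀ m n, P (m + 1 + n) * b m = 0 := by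
    intro m n
    induction n with
    | zero => rw [add_zero, hPs, sub_mul, hb1, hb2, sub_self]
    | succ n ih =>
      rw [← add_assoc, hPs, sub_mul, ih, ← hb3, mul_assoc, ih, mul_zero, sub_zero]
  have hbb : ∀ m n, m < n → b n * b m = 0 := by
    intro m n h
    obtain ⟨k, rfl⟩ := Nat.exists_eq_add_of_le (Nat.succ_le_of_lt h)
    rw [← hb3, mul_assoc, Nat.succ_eq_add_one, hPb, mul_zero]
  have hcP : ∀ n, c * P n = P n := by
    intro n
    induction n with
    | zero => exact hc
    | succ n ih => rw [hPs, mul_sub, ih, ← hb2, ← mul_assoc, ih]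
  have hcx : ∀ n, c (x n) = x n := by
    intro n
    have : x n ∈ LinearMap.range c := by rw [hx]; exact Submodule.subset_span ⟨n, rfl⟩
    obtain ⟨y, hy⟩ := this
    rw [← hy]
    exact LinearMap.congr_fun hc y
  have hsum : ∀ n, ∀ y, c y - P n y ∈ ⨆ i, LinearMap.range (b i) := by
    intro n y
    induction n with
    | zero => rw [hP0, sub_self]; exact Submodule.zero_mem _
    | succ n ih =>
      have : c y - P (n + 1) y = (c y - P n y) + b n y := by
        rw [hPs, LinearMap.sub_apply]; abel
      rw [this]
      exact Submodule.add_mem _ ih (Submodule.mem_iSup_of_mem n ⟨y, rfl⟩)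
  have hsup : ⨆ i, LinearMap.range (b i) = LinearMap.range c := by
    apply le_antisymm
    · refine iSup_le fun n => ?_
      rintro _ ⟨y, rfl⟩
      refine ⟨b n y, ?_⟩
      rw [← hb2, ← Module.End.mul_apply, ← mul_assoc, hcP]
    · rw [hx, Submodule.span_le]
      rintro _ ⟨n, rfl⟩
      have h1 := hsum n (x n)
      have h2 : P n (x n) ∈ ⨆ i, LinearMap.range (b i) :=
        Submodule.mem_iSup_of_mem n ⟨P n (x n), ha4 _ (hP n) _⟩
      have h3 := Submodule.add_mem _ h1 h2
      rwa [sub_add_cancel, hcx] at h3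
  obtain ⟨e⟩ := aux_order (fun i => LinearMap.range (b i)) b
    (by rintro i _ ⟨y, rfl⟩; exact LinearMap.congr_fun (hb1 i) y)
    (by rintro i k hk _ ⟨y, rfl⟩; exact LinearMap.congr_fun (hbb _ _ hk) y)
  obtain ⟨J, k, ⟨e'⟩⟩ := aux_sigma G (fun t : ULift.{w} ℕ => LinearMap.range (b t.down))
    (fun t => ha5 _ (hP t.down) _)
  exact ⟨J, k, ⟨((LinearEquiv.ofEq _ _ hsup.symm).trans e.symm).trans
    ((DFinsupp.domLCongr Equiv.ulift.symm).trans e')⟩⟩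

theorem aux_supp {R : Type*} [Ring R] {I : Type*} (G : I → Type*)
    [∀ j, AddCommGroup (G j)] [∀ j, Module R (G j)] {X : Type*} [AddCommGroup X] [Module R X]
    [hX : Module.Finite R X] (f : X →ₗ[R] Π₀ i, G i) :
    ∃ s : Finset I, ∀ x, ∀ i, i ∉ s → f x i = 0 := by
  classical
  obtain ⟨t, ht⟩ := hX.fg_top
  refine ⟨t.biUnion fun x => (f x).support, fun x i hi => ?_⟩
  have hx : x ∈ Submodule.span R (t : Set X) := by rw [ht]; trivial
  have : Submodule.span R (t : Set X) ≤ LinearMap.ker (DFinsupp.lapply i ∘ₗ f) := by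
    rw [Submodule.span_le]
    intro y hy
    simp only [Finset.mem_biUnion, not_exists, not_and, DFinsupp.mem_support_iff, not_not] at hi
    exact hi y hy
  exact this hx

theorem aux_closure {I : Type*} (s : I → Finset I) :
    ∃ K : I → Set I, ∀ i, i ∈ K i ∧ (K i).Countable ∧ ∀ j ∈ K i, ∀ l ∈ s j, l ∈ K i := by
  let F : I → ℕ → Set I := fun i n => Nat.rec {i} (fun _ S => ⋃ j ∈ S, (s j : Set I)) n
  have hF : ∀ i n, F i (n + 1) = ⋃ j ∈ F i n, (s j : Set I) := fun _ _ => rfl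
  refine ⟨fun i => ⋃ n, F i n, fun i => ⟨Set.mem_iUnion.2 ⟨0, rfl⟩, ?_, ?_⟩⟩
  · refine Set.countable_iUnion fun n => ?_
    induction n with
    | zero => exact Set.countable_singleton i
    | succ n ih =>
      rw [hF]
      exact ih.biUnion fun j _ => (s j).countable_toSet
  · intro j hj l hl
    obtain ⟨n, hn⟩ := Set.mem_iUnion.1 hj
    refine Set.mem_iUnion.2 ⟨n + 1, ?_⟩
    rw [hF]
    exact Set.mem_biUnion hn hl

open scoped Classical in
/-- projection onto the coordinates in `A` -/
noncomputable def auxProj (R : Type*) [Ring R] {I : Type*} (G : I → Type*)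
    [∀ j, AddCommGroup (G j)] [∀ j, Module R (G j)] (A : Set I) : Module.End R (Π₀ i, G i) :=
  DFinsupp.filterLinearMap R G (· ∈ A)

section
variable {R : Type*} [Ring R] {I : Type*} (G : I → Type*)
    [∀ j, AddCommGroup (G j)] [∀ j, Module R (G j)]

theorem auxProj_mul {A B : Set I} (h : B ⊆ A) : auxProj R G A * auxProj R G B = auxProj R G B := by
  classical
  refine LinearMap.ext fun x => ?_
  ext i
  simp only [auxProj, Module.End.mul_apply, DFinsupp.filterLinearMap_apply, DFinsupp.filter_apply]
  by_cases hi : i ∈ B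
  · simp [hi, h hi]
  · simp [hi]

theorem auxProj_mul' {A B : Set I} (h : B ⊆ A) : auxProj R G B * auxProj R G A = auxProj R G B := by
  classical
  refine LinearMap.ext fun x => ?_
  ext i
  simp only [auxProj, Module.End.mul_apply, DFinsupp.filterLinearMap_apply, DFinsupp.filter_apply]
  by_cases hi : i ∈ B
  · simp [hi, h hi]
  · simp [hi]

theorem auxProj_single [DecidableEq I] {A : Set I} {i : I} (h : i ∈ A) (g : G i) :
    auxProj R G A (DFinsupp.single i g) = DFinsupp.single i g := by
  classical
  simp only [auxProj, DFinsupp.filterLinearMap_apply]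
  exact DFinsupp.filter_single_pos _ _ h

theorem auxProj_single' [DecidableEq I] {A : Set I} {i : I} (h : i ∉ A) (g : G i) :
    auxProj R G A (DFinsupp.single i g) = 0 := by
  classical
  simp only [auxProj, DFinsupp.filterLinearMap_apply]
  exact DFinsupp.filter_single_neg _ _ h

theorem auxProj_inv [DecidableEq I] (p : Module.End R (Π₀ i, G i)) (s : I → Finset I)
    (hs : ∀ j g i, i ∉ s j → p (DFinsupp.single j g) i = 0) (A : Set I)
    (hA : ∀ j ∈ A, ∀ l ∈ s j, l ∈ A) : auxProj R G A * p * auxProj R G A = p * auxProj R G A := by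
  classical
  refine DFinsupp.lhom_ext fun j g => ?_
  by_cases hj : j ∈ A
  · simp only [Module.End.mul_apply, auxProj_single G hj]
    ext i
    simp only [auxProj, DFinsupp.filterLinearMap_apply, DFinsupp.filter_apply]
    split_ifs with hi
    · rfl
    · exact (hs _ _ _ fun h => hi (hA j hj i h)).symm
  · simp [auxProj_single' G hj]
end

theorem aux_main {R : Type*} [Ring R] {I : Type w} (G : I → Type*)
    [∀ j, AddCommGroup (G j)] [∀ j, Module R (G j)] (hG : ∀ j, IsLocalRing (Module.End R (G j)))
    (hfg : ∀ j, Module.Finite R (G j))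
    (p : Module.End R (Π₀ i, G i)) (hp : p * p = p) :
    ∃ (J : Type w) (k : J → I), Nonempty (LinearMap.range p ≃ₗ[R] Π₀ j, G (k j)) := by
  classical
  obtain ⟨_, _⟩ := exists_wellFoundedLT I
  have h0 : ∀ j, ∃ s : Finset I, ∀ g i, i ∉ s → p (DFinsupp.single j g) i = 0 := fun j =>
    aux_supp G (p ∘ₗ DFinsupp.lsingle j)
  choose s hs using h0
  obtain ⟨K, hK⟩ := aux_closure s
  choose hK1 hK2 hK3 using hK
  let A : I → Set I := fun i => ⋃ k, ⋃ (_ : k < i), K k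
  let B : I → Set I := fun i => ⋃ k, ⋃ (_ : k ≤ i), K k
  have hAB : ∀ i, A i ⊆ B i := fun i => by
    refine Set.iUnion₂_subset fun k hk => ?_
    exact Set.subset_iUnion₂_of_subset k hk.le subset_rfl
  have hBA : ∀ k i, k < i → B k ⊆ A i := fun k i h => by
    refine Set.iUnion₂_subset fun l hl => ?_
    exact Set.subset_iUnion₂_of_subset l (hl.trans_lt h) subset_rfl
  have hA : ∀ i, ∀ j ∈ A i, ∀ l ∈ s j, l ∈ A i := by
    intro i j hj l hl
    simp only [A, Set.mem_iUnion] at hj ⊢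
    obtain ⟨k, hk, hj⟩ := hj
    exact ⟨k, hk, hK3 k j hj l hl⟩
  have hB : ∀ i, ∀ j ∈ B i, ∀ l ∈ s j, l ∈ B i := by
    intro i j hj l hl
    simp only [B, Set.mem_iUnion] at hj ⊢
    obtain ⟨k, hk, hj⟩ := hj
    exact ⟨k, hk, hK3 k j hj l hl⟩
  let u : I → Module.End R (Π₀ i, G i) := fun i => auxProj R G (A i)
  let v : I → Module.End R (Π₀ i, G i) := fun i => auxProj R G (B i)
  have hu : ∀ i, u i * p * u i = p * u i := fun i => auxProj_inv G p s hs _ (hA i)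
  have hv : ∀ i, v i * p * v i = p * v i := fun i => auxProj_inv G p s hs _ (hB i)
  have hvu : ∀ i, v i * u i = u i := fun i => auxProj_mul G (hAB i)
  have hvv : ∀ i, v i * v i = v i := fun i => auxProj_mul G subset_rfl
  have huv : ∀ k i, k < i → u i * v k = v k := fun k i h => auxProj_mul G (hBA k i h)
  let c : I → Module.End R (Π₀ i, G i) := fun i => p * v i - p * u i * (p * v i)
  have hpc : ∀ i, p * c i = c i := fun i => by
    simp only [c, mul_sub, ← mul_assoc, hp]
  have hcu : ∀ i, c i * u i = 0 := fun i => by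
    simp only [c, sub_mul]
    rw [mul_assoc p, hvu, mul_assoc (p * u i), mul_assoc p (v i), hvu, mul_assoc p, ← mul_assoc (u i), hu,
      ← mul_assoc, hp, sub_self]
  have hcv : ∀ i, c i * v i = c i := fun i => by
    simp only [c, sub_mul]
    rw [mul_assoc p, hvv, mul_assoc (p * u i), mul_assoc p (v i), hvv]
  have hvpu : ∀ i, v i * (p * u i) = p * u i := fun i => by
    rw [← hu, ← mul_assoc, ← mul_assoc, hvu]
  have hvc : ∀ i, v i * c i = c i := fun i => by
    simp only [c, mul_sub]
    rw [← mul_assoc, hv, ← mul_assoc, hvpu]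
  have hcpu : ∀ i, c i * (p * u i) = 0 := fun i => by
    rw [← hu, ← mul_assoc, ← mul_assoc, hcu, zero_mul, zero_mul]
  have hcc : ∀ i, c i * c i = c i := fun i => by
    conv_lhs => rhs; simp only [c]
    rw [mul_sub, ← mul_assoc (c i) (p * u i), hcpu, zero_mul, sub_zero]
    have : p * v i * (p * v i) = p * v i := by
      rw [mul_assoc, ← mul_assoc (v i), hv, ← mul_assoc, hp]
    simp only [c]
    rw [sub_mul, mul_assoc (p * u i), this]
  have hci : ∀ i, ∃ (J : Type w) (k : J → I), Nonempty (LinearMap.range (c i) ≃ₗ[R] Π₀ j, G (k j)) := by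
    intro i
    choose t ht using fun j => (hfg j).fg_top
    let T : Set (Π₀ i, G i) := ⋃ j ∈ K i, (fun g => DFinsupp.single j g) '' (t j : Set (G j))
    have hT : T.Countable := (hK2 i).biUnion fun j _ => (t j).countable_toSet.image _
    obtain ⟨x, hx⟩ := ((hT.insert 0).image (c i)).exists_eq_range ((Set.insert_nonempty _ _).image _)
    refine aux_countable G hG (c i) (hcc i) x ?_
    rw [← hx]
    apply le_antisymm
    · rintro _ ⟨y, rfl⟩
      induction y using DFinsupp.induction with
      | h0 => simp
      | ha j g f _ _ ih =>
        rw [map_add]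
        refine Submodule.add_mem _ ?_ ih
        by_cases hjB : j ∈ B i
        · by_cases hjA : j ∈ A i
          · rw [← auxProj_single (R := R) G hjA, ← Module.End.mul_apply]
            change (c i * u i) _ ∈ _
            rw [hcu]; simp
          · have hjK : j ∈ K i := by
              simp only [A, B, Set.mem_iUnion] at hjA hjB
              obtain ⟨k, hk, hj⟩ := hjB
              rcases hk.lt_or_eq with h | h
              · exact absurd ⟨k, h, hj⟩ hjA
              · rwa [← h]
            rw [Submodule.span_image]
            refine Submodule.mem_map_of_mem ?_
            have hg : g ∈ Submodule.span R (t j : Set (G j)) := by rw [ht]; trivial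
            have : Submodule.span R (t j : Set (G j)) ≤
                (Submodule.span R (insert 0 T)).comap (DFinsupp.lsingle j) := by
              rw [Submodule.span_le]
              intro g hg
              refine Submodule.subset_span (Set.mem_insert_of_mem _ ?_)
              exact Set.mem_biUnion hjK ⟨g, hg, rfl⟩
            exact this hg
        · rw [← hcv, Module.End.mul_apply]
          change c i (auxProj R G (B i) _) ∈ _
          rw [auxProj_single' G hjB]; simp
    · rw [Submodule.span_le]
      rintro _ ⟨y, _, rfl⟩
      exact ⟨y, rfl⟩
  have hle : ∀ i y, p (v i y) ∈ ⨆ i, LinearMap.range (c i) := by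
    intro i
    induction i using WellFoundedLT.induction with
    | ind i ih =>
    have h1 : ∀ z, p (u i z) ∈ ⨆ i, LinearMap.range (c i) := by
      intro z
      induction z using DFinsupp.induction with
      | h0 => simp
      | ha j g f _ _ ihf =>
        rw [map_add, map_add]
        refine Submodule.add_mem _ ?_ ihf
        by_cases hj : j ∈ A i
        · change p (auxProj R G (A i) _) ∈ _
          rw [auxProj_single G hj]
          simp only [A, Set.mem_iUnion] at hj
          obtain ⟨k, hk, hj⟩ := hj
          have := ih k hk (DFinsupp.single j g)
          change p (auxProj R G (B k) _) ∈ _ at this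
          rwa [auxProj_single G] at this
          simp only [B, Set.mem_iUnion]
          exact ⟨k, le_rfl, hj⟩
        · change p (auxProj R G (A i) _) ∈ _
          rw [auxProj_single' G hj]; simp
    intro y
    have : p (v i y) = c i y + p (u i (p (v i y))) := by
      simp [c]
    rw [this]
    exact Submodule.add_mem _ (Submodule.mem_iSup_of_mem i ⟨y, rfl⟩) (h1 _)
  have hsup : ⨆ i, LinearMap.range (c i) = LinearMap.range p := by
    apply le_antisymm
    · refine iSup_le fun n => ?_
      rintro _ ⟨y, rfl⟩
      exact ⟨c n y, LinearMap.congr_fun (hpc n) y⟩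
    · rintro _ ⟨y, rfl⟩
      induction y using DFinsupp.induction with
      | h0 => simp
      | ha j g f _ _ ihf =>
        rw [map_add]
        refine Submodule.add_mem _ ?_ ihf
        have := hle j (DFinsupp.single j g)
        change p (auxProj R G (B j) _) ∈ _ at this
        rwa [auxProj_single G] at this
        simp only [B, Set.mem_iUnion]
        exact ⟨j, le_rfl, hK1 j⟩
  obtain ⟨e⟩ := aux_order (fun i => LinearMap.range (c i)) c
    (by rintro i _ ⟨y, rfl⟩; exact LinearMap.congr_fun (hcc i) y)
    (by
      rintro i k hk _ ⟨y, rfl⟩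
      have : c i * c k = 0 := by
        rw [← hvc k, ← huv k i hk, mul_assoc, ← mul_assoc (c i), hcu, zero_mul]
      exact LinearMap.congr_fun this y)
  obtain ⟨J, k, ⟨e'⟩⟩ := aux_sigma G (fun t => LinearMap.range (c t)) hci
  exact ⟨J, k, ⟨((LinearEquiv.ofEq _ _ hsup.symm).trans e.symm).trans e'⟩⟩

theorem aux_idem_local {S : Type*} [Ring S] [IsLocalRing S] (a : S) (ha : a * a = a) :
    a = 0 ∨ a = 1 := by
  rcases IsLocalRing.isUnit_or_isUnit_of_add_one (show a + (1 - a) = 1 by abel) with h | h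
  · right
    exact h.mul_left_cancel (by rw [ha, mul_one])
  · left
    exact h.mul_left_cancel (by rw [sub_mul, ha, one_mul, sub_self, mul_zero])

theorem aux_unit_left {S : Type*} [Ring S] [IsLocalRing S] {a b : S} (h : b * a = 1) :
    IsUnit a := by
  have hab : a * b * (a * b) = a * b := by rw [mul_assoc, ← mul_assoc b, h, one_mul]
  rcases aux_idem_local _ hab with h0 | h0
  · exfalso
    have : (1 : S) = 0 := by
      calc (1 : S) = b * (a * b) * a := by rw [← mul_assoc b, h, one_mul, h]
        _ = 0 := by rw [h0, mul_zero, zero_mul]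
    exact one_ne_zero this
  · exact ⟨⟨a, b, h0, h⟩, rfl⟩

theorem aux_unit_left' {S : Type*} [Ring S] [IsLocalRing S] {a b : S} (h : IsUnit (b * a)) :
    IsUnit a := by
  obtain ⟨c, hc⟩ := h.exists_left_inv
  exact aux_unit_left (b := c * b) (by rw [mul_assoc, hc])

theorem aux_unit_right' {S : Type*} [Ring S] [IsLocalRing S] {a b : S} (h : IsUnit (b * a)) :
    IsUnit b := by
  obtain ⟨c, hc⟩ := h.exists_right_inv
  rw [mul_assoc] at hc
  have h1 : IsUnit (a * c) := aux_unit_left hc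
  have h2 : b = ↑(h1.unit⁻¹) := by
    have : b * h1.unit = 1 := hc
    exact eq_comm.1 (Units.inv_eq_of_mul_eq_one_left this)
  rw [h2]
  exact Units.isUnit _

/-- the ideal of nonunits of a (noncommutative) local ring -/
def auxJ (S : Type*) [Ring S] [IsLocalRing S] : Ideal S where
  carrier := nonunits S
  add_mem' := IsLocalRing.nonunits_add
  zero_mem' := by simp
  smul_mem' := fun _ _ hx h => hx (aux_unit_left' h)

theorem mem_auxJ {S : Type*} [Ring S] [IsLocalRing S] {a : S} : a ∈ auxJ S ↔ ¬ IsUnit a := Iff.rfl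

instance auxJ_two (S : Type*) [Ring S] [IsLocalRing S] : (auxJ S).IsTwoSided :=
  ⟨fun _ h h' => h (aux_unit_right' h')⟩

theorem aux_ibn (S : Type*) [Ring S] [IsLocalRing S] : InvariantBasisNumber (S ⧸ auxJ S) := by
  have : Nontrivial (S ⧸ auxJ S) := by
    refine ⟨1, 0, fun h => ?_⟩
    rw [← map_one (Ideal.Quotient.mk (auxJ S)), Ideal.Quotient.eq_zero_iff_mem, mem_auxJ] at h
    exact h isUnit_one
  let _ : DivisionRing (S ⧸ auxJ S) := DivisionRing.ofIsUnitOrEqZero (fun a => by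
    obtain ⟨a, rfl⟩ := Ideal.Quotient.mk_surjective a
    by_cases ha : IsUnit a
    · exact Or.inl (ha.map _)
    · right
      rw [Ideal.Quotient.eq_zero_iff_mem, mem_auxJ]
      exact ha)
  infer_instance

theorem aux_op (S : Type*) [Ring S] [IsLocalRing S] : IsLocalRing Sᵐᵒᵖ :=
  ⟨fun {a b} h => by
    have h' : a.unop + b.unop = 1 := by rw [← MulOpposite.unop_add, h]; rfl
    rcases IsLocalRing.isUnit_or_isUnit_of_add_one h' with h | h
    · exact Or.inl (by simpa using h.op)
    · exact Or.inr (by simpa using h.op)⟩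

theorem aux_card {D W S : Type*} {I K : Type w} [Ring D] [InvariantBasisNumber D] [AddCommGroup W]
    (mk : S → D) (hmk : Function.Surjective mk) (act : W → S → W)
    (T₁ : W →+ (I →₀ D)) (T₂ : W →+ (K →₀ D)) (h₁ : Function.Surjective T₁)
    (h₂ : Function.Surjective T₂) (ha₁ : ∀ w s, T₁ (act w s) = mk s • T₁ w)
    (ha₂ : ∀ w s, T₂ (act w s) = mk s • T₂ w) (hk : ∀ w, T₁ w = 0 ↔ T₂ w = 0) :
    Cardinal.mk I = Cardinal.mk K := by
  have hk' : ∀ w w', T₁ w = T₁ w' ↔ T₂ w = T₂ w' := fun w w' => by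
    rw [← sub_eq_zero, ← map_sub, hk, map_sub, sub_eq_zero]
  choose σ hσ using h₁
  have key : ∀ w, T₂ (σ (T₁ w)) = T₂ w := fun w => by rw [← hk', hσ]
  let e : (I →₀ D) →ₗ[D] (K →₀ D) :=
    { toFun := fun x => T₂ (σ x)
      map_add' := fun x y => by
        rw [← map_add, ← hk', map_add, hσ, hσ, hσ]
      map_smul' := fun d x => by
        obtain ⟨s, rfl⟩ := hmk d
        rw [RingHom.id_apply, ← ha₂, ← hk', ha₁, hσ, hσ] }
  have he : Function.Bijective e := by
    constructor
    · intro x y h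
      have h : T₂ (σ x) = T₂ (σ y) := h
      rwa [← hk', hσ, hσ] at h
    · intro y
      obtain ⟨w, rfl⟩ := h₂ y
      exact ⟨T₁ w, key w⟩
  exact mk_eq_mk_of_basis' (Finsupp.basisSingleOne (R := D) (ι := I))
    ((Finsupp.basisSingleOne (R := D) (ι := K)).map (LinearEquiv.ofBijective e he).symm)

theorem aux_iso {R : Type*} [Ring R] {A B : Type*} [AddCommGroup A] [Module R A] [AddCommGroup B]
    [Module R B] (hA : IsLocalRing (Module.End R A)) (hB : IsLocalRing (Module.End R B))
    (h : B →ₗ[R] A) (k : A →ₗ[R] B) (hu : IsUnit (M := Module.End R B) (k ∘ₗ h)) :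
    Nonempty (A ≃ₗ[R] B) := by
  obtain ⟨c, hc⟩ := hu.exists_left_inv
  let k' : A →ₗ[R] B := c ∘ₗ k
  have h1 : k' ∘ₗ h = LinearMap.id := hc
  have h1' : ∀ x, k' (h x) = x := fun x => LinearMap.congr_fun h1 x
  rcases aux_idem_local (S := Module.End R A) (h ∘ₗ k') (by
    refine LinearMap.ext fun x => ?_
    simp [h1']) with h0 | h0
  · exfalso
    apply one_ne_zero (α := Module.End R B)
    refine LinearMap.ext fun x => ?_
    have := congrArg k' (LinearMap.congr_fun h0 (h x))
    simpa [h1'] using this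
  · exact ⟨LinearEquiv.ofLinearMap k' h h1 h0⟩

theorem aux_T {R : Type*} [Ring R] {I : Type*} (A : I → Type*)
    [∀ j, AddCommGroup (A j)] [∀ j, Module R (A j)] (hA : ∀ j, IsLocalRing (Module.End R (A j)))
    (G₀ : Type*) [AddCommGroup G₀] [Module R G₀] [hl : IsLocalRing (Module.End R G₀)]
    [IsLocalRing (Module.End R G₀)ᵐᵒᵖ] [Module.Finite R G₀] :
    ∃ T : (G₀ →ₗ[R] Π₀ i, A i) →+ ({i // Nonempty (A i ≃ₗ[R] G₀)} →₀
        ((Module.End R G₀)ᵐᵒᵖ ⧸ auxJ (Module.End R G₀)ᵐᵒᵖ)),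
      Function.Surjective T ∧
      (∀ f (s : (Module.End R G₀)ᵐᵒᵖ), T (f ∘ₗ s.unop) = Ideal.Quotient.mk (auxJ _) s • T f) ∧
      (∀ f, T f = 0 ↔ ∀ g : (Π₀ i, A i) →ₗ[R] G₀, ¬ IsUnit (M := Module.End R G₀) (g ∘ₗ f)) := by
  classical
  let α : ∀ i : {i // Nonempty (A i ≃ₗ[R] G₀)}, A i ≃ₗ[R] G₀ := fun i => i.2.some
  let q := Ideal.Quotient.mk (auxJ (Module.End R G₀)ᵐᵒᵖ)
  let t : (G₀ →ₗ[R] Π₀ i, A i) → {i // Nonempty (A i ≃ₗ[R] G₀)} → Module.End R G₀ :=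
    fun f i => (α i).toLinearMap ∘ₗ DFinsupp.lapply i.1 ∘ₗ f
  have hq0 : ∀ x : Module.End R G₀, q (MulOpposite.op x) = 0 ↔ ¬ IsUnit x := by
    intro x
    rw [Ideal.Quotient.eq_zero_iff_mem, mem_auxJ, isUnit_op]
  let T : (G₀ →ₗ[R] Π₀ i, A i) →+ ({i // Nonempty (A i ≃ₗ[R] G₀)} →₀
        ((Module.End R G₀)ᵐᵒᵖ ⧸ auxJ (Module.End R G₀)ᵐᵒᵖ)) :=
    { toFun := fun f => Finsupp.ofSupportFinite (fun i => q (MulOpposite.op (t f i))) (by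
        obtain ⟨s, hs⟩ := aux_supp A f
        refine Set.Finite.subset (s.finite_toSet.preimage Subtype.val_injective.injOn) ?_
        intro i hi
        by_contra hi'
        apply hi
        have : t f i = 0 := by
          refine LinearMap.ext fun x => ?_
          simp [t, hs x i hi']
        simp [this])
      map_zero' := by
        ext i
        simp [Finsupp.ofSupportFinite_coe, t]
      map_add' := fun f g => by
        ext i
        simp [Finsupp.ofSupportFinite_coe, t, LinearMap.comp_add] }
  have hT : ∀ f i, T f i = q (MulOpposite.op (t f i)) := fun f i => rfl
  refine ⟨T, ?_, ?_, ?_⟩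
  · intro y
    induction y using Finsupp.induction_linear with
    | zero => exact ⟨0, map_zero _⟩
    | add x y hx hy =>
      obtain ⟨a, rfl⟩ := hx
      obtain ⟨b, rfl⟩ := hy
      exact ⟨a + b, map_add _ _ _⟩
    | single i d =>
      obtain ⟨s, rfl⟩ := Ideal.Quotient.mk_surjective d
      refine ⟨DFinsupp.lsingle i.1 ∘ₗ (α i).symm.toLinearMap ∘ₗ s.unop, ?_⟩
      ext j
      rw [hT]
      by_cases hij : i = j
      · subst hij
        rw [Finsupp.single_eq_same]
        have : t (DFinsupp.lsingle i.1 ∘ₗ (α i).symm.toLinearMap ∘ₗ s.unop) i = s.unop := by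
          refine LinearMap.ext fun x => ?_
          simp [t]
        rw [this]; rfl
      · rw [Finsupp.single_eq_of_ne (Ne.symm hij)]
        have hij' : i.1 ≠ j.1 := fun h => hij (Subtype.ext h)
        have : t (DFinsupp.lsingle i.1 ∘ₗ (α i).symm.toLinearMap ∘ₗ s.unop) j = 0 := by
          refine LinearMap.ext fun x => ?_
          simp [t, DFinsupp.single_eq_of_ne (Ne.symm hij')]
        rw [this]; simp
  · intro f s
    ext i
    rw [hT, Finsupp.smul_apply, hT, smul_eq_mul]
    change _ = q s * _
    rw [← map_mul]
    rfl
  · intro f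
    constructor
    · intro hf g hg
      obtain ⟨s, hs⟩ := aux_supp A f
      have hsum : (g ∘ₗ f : Module.End R G₀) =
          ∑ i ∈ s, ((g ∘ₗ DFinsupp.lsingle i) ∘ₗ (DFinsupp.lapply i ∘ₗ f) : Module.End R G₀) := by
        refine LinearMap.ext fun x => ?_
        have h1 : f x = ∑ i ∈ s, DFinsupp.single i (f x i) := by
          ext j
          rw [DFinsupp.finsetSum_apply]
          by_cases hj : j ∈ s
          · rw [Finset.sum_eq_single_of_mem j hj]
            · simp
            · intro b _ hb
              exact DFinsupp.single_eq_of_ne (Ne.symm hb)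
          · rw [hs x j hj, Finset.sum_eq_zero]
            intro b hb
            exact DFinsupp.single_eq_of_ne (fun h => hj (h ▸ hb))
        rw [LinearMap.sum_apply]
        simp only [LinearMap.comp_apply, DFinsupp.lsingle_apply, DFinsupp.lapply_apply]
        conv_lhs => rw [h1]
        rw [map_sum]
      rw [hsum] at hg
      obtain ⟨i, _, hi⟩ := IsLocalRing.exists_of_isUnit_sum hg
      have hiso := aux_iso (hA i) hl _ _ hi
      have h2 := DFunLike.congr_fun hf ⟨i, hiso⟩
      rw [hT, Finsupp.zero_apply, hq0] at h2
      apply h2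
      apply aux_unit_left' (b := ((g ∘ₗ DFinsupp.lsingle i) ∘ₗ (α ⟨i, hiso⟩).symm.toLinearMap :
        Module.End R G₀))
      convert hi using 1
      refine LinearMap.ext fun x => ?_
      simp [t]
    · intro h
      ext i
      rw [hT, Finsupp.zero_apply, hq0]
      exact h ((α i).toLinearMap ∘ₗ DFinsupp.lapply i.1)

theorem aux_count {R : Type*} [Ring R] {I K : Type w} (A : I → Type*) (B : K → Type*)
    [∀ j, AddCommGroup (A j)] [∀ j, Module R (A j)] (hA : ∀ j, IsLocalRing (Module.End R (A j)))
    [∀ j, AddCommGroup (B j)] [∀ j, Module R (B j)] (hB : ∀ j, IsLocalRing (Module.End R (B j)))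
    (hAf : ∀ j, Module.Finite R (A j)) (hBf : ∀ j, Module.Finite R (B j))
    (Φ : (Π₀ i, A i) ≃ₗ[R] (Π₀ i, B i))
    (G₀ : Type*) [AddCommGroup G₀] [Module R G₀] (hl : IsLocalRing (Module.End R G₀)) :
    Cardinal.mk {i // Nonempty (A i ≃ₗ[R] G₀)} = Cardinal.mk {i // Nonempty (B i ≃ₗ[R] G₀)} := by
  by_cases hfin : Module.Finite R G₀
  · have hop := aux_op (Module.End R G₀)
    have := aux_ibn (Module.End R G₀)ᵐᵒᵖ
    obtain ⟨T₁, hs₁, ha₁, hk₁⟩ := aux_T A hA G₀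
    obtain ⟨T₂, hs₂, ha₂, hk₂⟩ := aux_T B hB G₀
    let ψ : (G₀ →ₗ[R] Π₀ i, A i) →+ (G₀ →ₗ[R] Π₀ i, B i) :=
      { toFun := fun f => Φ.toLinearMap ∘ₗ f
        map_zero' := by simp
        map_add' := fun f g => by simp [LinearMap.comp_add] }
    refine aux_card (Ideal.Quotient.mk (auxJ _)) Ideal.Quotient.mk_surjective
      (fun f (s : (Module.End R G₀)ᵐᵒᵖ) => f ∘ₗ s.unop) T₁ (T₂.comp ψ) hs₁ (hs₂.comp ?_) ha₁ ?_ ?_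
    · intro f
      refine ⟨Φ.symm.toLinearMap ∘ₗ f, ?_⟩
      refine LinearMap.ext fun x => ?_
      simp [ψ]
    · intro w s
      exact ha₂ (Φ.toLinearMap ∘ₗ w) s
    · intro w
      rw [hk₁]
      refine Iff.trans ?_ (hk₂ (Φ.toLinearMap ∘ₗ w)).symm
      constructor
      · intro h g
        exact h (g ∘ₗ Φ.toLinearMap)
      · intro h g
        have := h (g ∘ₗ Φ.symm.toLinearMap)
        convert this using 2
        refine LinearMap.ext fun x => ?_
        simp
  · have h1 : IsEmpty {i // Nonempty (A i ≃ₗ[R] G₀)} :=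
      ⟨fun i => hfin (by have := hAf i.1; exact Module.Finite.equiv i.2.some)⟩
    have h2 : IsEmpty {i // Nonempty (B i ≃ₗ[R] G₀)} :=
      ⟨fun i => hfin (by have := hBf i.1; exact Module.Finite.equiv i.2.some)⟩
    rw [Cardinal.mk_eq_zero, Cardinal.mk_eq_zero]

theorem aux_sum {R : Type*} [Ring R] {I K K' : Type*} (G : I → Type*)
    [∀ j, AddCommGroup (G j)] [∀ j, Module R (G j)] (k : K → I) (k' : K' → I) :
    Nonempty (((Π₀ a, G (k a)) × (Π₀ a, G (k' a))) ≃ₗ[R] Π₀ x : K ⊕ K', G (Sum.elim k k' x)) := by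
  classical
  let F : (Π₀ x : K ⊕ K', G (Sum.elim k k' x)) →ₗ[R] ((Π₀ a, G (k a)) × (Π₀ a, G (k' a))) :=
    DFinsupp.lsum ℕ (fun x => match x with
      | Sum.inl a => LinearMap.inl R _ _ ∘ₗ DFinsupp.lsingle (R := R) (M := fun a => G (k a)) a
      | Sum.inr a => LinearMap.inr R _ _ ∘ₗ DFinsupp.lsingle (R := R) (M := fun a => G (k' a)) a)
  let B1 : (Π₀ a, G (k a)) →ₗ[R] (Π₀ x : K ⊕ K', G (Sum.elim k k' x)) :=
    DFinsupp.lsum ℕ fun a => DFinsupp.lsingle (R := R) (M := fun x => G (Sum.elim k k' x)) (Sum.inl a)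
  let B2 : (Π₀ a, G (k' a)) →ₗ[R] (Π₀ x : K ⊕ K', G (Sum.elim k k' x)) :=
    DFinsupp.lsum ℕ fun a => DFinsupp.lsingle (R := R) (M := fun x => G (Sum.elim k k' x)) (Sum.inr a)
  have hFl : ∀ a g, F (DFinsupp.single (Sum.inl a) g) = (DFinsupp.single a g, 0) := fun a g =>
    DFinsupp.lsum_single ℕ _ _ _
  have hFr : ∀ a g, F (DFinsupp.single (Sum.inr a) g) = (0, DFinsupp.single a g) := fun a g =>
    DFinsupp.lsum_single ℕ _ _ _
  have hB1 : ∀ a g, B1 (DFinsupp.single a g) = DFinsupp.single (Sum.inl a) g := fun a g =>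
    DFinsupp.lsum_single ℕ _ _ _
  have hB2 : ∀ a g, B2 (DFinsupp.single a g) = DFinsupp.single (Sum.inr a) g := fun a g =>
    DFinsupp.lsum_single ℕ _ _ _
  refine ⟨LinearEquiv.ofLinearMap (LinearMap.coprod B1 B2) F ?_ ?_⟩
  · refine DFinsupp.lhom_ext fun x g => ?_
    rcases x with a | a
    · simp only [LinearMap.comp_apply, hFl, LinearMap.coprod_apply, map_zero, add_zero,
        LinearMap.id_apply]
      exact hB1 a g
    · simp only [LinearMap.comp_apply, hFr, LinearMap.coprod_apply, map_zero, zero_add,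
        LinearMap.id_apply]
      exact hB2 a g
  · apply LinearMap.prod_ext
    · refine DFinsupp.lhom_ext fun x g => ?_
      simp only [LinearMap.comp_apply, LinearMap.inl_apply, LinearMap.coprod_apply, map_zero,
        add_zero, hB1, LinearMap.id_apply]
      exact hFl x g
    · refine DFinsupp.lhom_ext fun x g => ?_
      simp only [LinearMap.comp_apply, LinearMap.inr_apply, LinearMap.coprod_apply, map_zero,
        zero_add, hB2, LinearMap.id_apply]
      exact hFr x g

theorem aux_internal {R : Type*} [Ring R] {K : Type*} [DecidableEq K] (B : K → Type*)
    [∀ j, AddCommGroup (B j)] [∀ j, Module R (B j)] {X : Type*} [AddCommGroup X] [Module R X]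
    (e : X ≃ₗ[R] Π₀ a, B a) : ∃ F : K → Submodule R X, DirectSum.IsInternal F ∧
      ∀ a, Nonempty (F a ≃ₗ[R] B a) := by
  classical
  let f : ∀ a, B a →ₗ[R] X := fun a => e.symm.toLinearMap ∘ₗ DFinsupp.lsingle a
  have hf : ∀ a g, f a g = e.symm (DFinsupp.single a g) := fun _ _ => rfl
  refine ⟨fun a => LinearMap.range (f a), ?_, fun a => ⟨(LinearEquiv.ofInjective (f a) ?_).symm⟩⟩
  · apply DirectSum.isInternal_submodule_of_iSupIndep_of_iSup_eq_top
    · intro a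
      rw [Submodule.disjoint_def]
      rintro _ ⟨g, rfl⟩ h
      have hle : (⨆ j, ⨆ (_ : j ≠ a), LinearMap.range (f j)) ≤
          LinearMap.ker (DFinsupp.lapply a ∘ₗ e.toLinearMap) := by
        refine iSup₂_le fun j hj => ?_
        rintro _ ⟨x, rfl⟩
        simp [hf, DFinsupp.single_eq_of_ne (Ne.symm hj)]
      have := hle h
      have : g = 0 := by simpa [hf] using this
      simp [this]
    · rw [eq_top_iff]
      intro x _
      rw [← e.symm_apply_apply x]
      induction e x using DFinsupp.induction with
      | h0 => simp
      | ha j g y _ _ ih =>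
        rw [map_add]
        exact Submodule.add_mem _ (Submodule.mem_iSup_of_mem j ⟨g, rfl⟩) ih
  · exact e.symm.injective.comp (DFinsupp.single_injective)

theorem aux_summand {R : Type*} [Ring R] {I : Type w} (G : I → Type*)
    [∀ j, AddCommGroup (G j)] [∀ j, Module R (G j)] (hG : ∀ j, IsLocalRing (Module.End R (G j)))
    (hfg : ∀ j, Module.Finite R (G j)) {X : Type*} [AddCommGroup X] [Module R X]
    (i : X →ₗ[R] Π₀ i, G i) (r : (Π₀ i, G i) →ₗ[R] X) (hri : ∀ x, r (i x) = x) :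
    ∃ (J : Type w) (k : J → I), Nonempty (X ≃ₗ[R] Π₀ j, G (k j)) := by
  obtain ⟨J, k, ⟨e⟩⟩ := aux_main G hG hfg (i ∘ₗ r) (by
    refine LinearMap.ext fun x => ?_
    simp [hri])
  have : LinearMap.range (i ∘ₗ r) = LinearMap.range i := by
    apply le_antisymm
    · rintro _ ⟨z, rfl⟩; exact ⟨_, rfl⟩
    · rintro _ ⟨z, rfl⟩; exact ⟨i z, by simp [hri]⟩
  exact ⟨J, k, ⟨((LinearEquiv.ofInjective i (Function.LeftInverse.injective hri)).trans
    (LinearEquiv.ofEq _ _ this.symm)).trans e⟩⟩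


open scoped Classical in
/-- Crawley–Jónsson–Warfield/Azumaya: if `M = ⨁ᵢ Gᵢ` with each `Gᵢ` finitely generated with local
endomorphism ring and `M = L ⊕ N` internally, then `L` and `N` decompose into direct sums of
submodules each isomorphic to some `Gᵢ`, and multiplicities add up. -/
theorem direct_summand_decomposition {R : Type u} [Ring R] {M : Type v} [AddCommGroup M]
    [Module R M] {I : Type w} (G : I → Submodule R M)
    (hG : DirectSum.IsInternal G)
    (hfg : ∀ i, Module.Finite R ↥(G i))
    (hloc : ∀ i, IsLocalRing (Module.End R ↥(G i)))
    (L N : Submodule R M) (hLN : IsCompl L N) :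
    ∃ (I' : Type w) (I'' : Type w) (Lfam : I' → Submodule R ↥L) (Nfam : I'' → Submodule R ↥N),
      DirectSum.IsInternal Lfam ∧ DirectSum.IsInternal Nfam ∧
      (∀ j : I', ∃ i : I, Nonempty (↥(Lfam j) ≃ₗ[R] ↥(G i))) ∧
      (∀ t : I'', ∃ i : I, Nonempty (↥(Nfam t) ≃ₗ[R] ↥(G i))) ∧
      (∀ (G₀ : Type v) [AddCommGroup G₀] [Module R G₀], IsLocalRing (Module.End R G₀) →
        Cardinal.mk {i : I // Nonempty (↥(G i) ≃ₗ[R] G₀)} =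
          Cardinal.mk {j : I' // Nonempty (↥(Lfam j) ≃ₗ[R] G₀)} +
          Cardinal.mk {t : I'' // Nonempty (↥(Nfam t) ≃ₗ[R] G₀)}) := by
  classical
  have e0 : Nonempty ((Π₀ i, G i) ≃ₗ[R] M) :=
    ⟨LinearEquiv.ofBijective (DirectSum.coeLinearMap G) hG⟩
  obtain ⟨e⟩ := e0
  let P := (Submodule.prodEquivOfIsCompl L N hLN)
  obtain ⟨I', k, ⟨eL⟩⟩ := aux_summand (fun i => G i) hloc hfg
    (e.symm.toLinearMap ∘ₗ P.toLinearMap ∘ₗ LinearMap.inl R L N)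
    (LinearMap.fst R L N ∘ₗ P.symm.toLinearMap ∘ₗ e.toLinearMap) (fun x => by
      simp only [LinearMap.comp_apply, LinearEquiv.coe_coe, LinearEquiv.apply_symm_apply,
        LinearEquiv.symm_apply_apply]; rfl)
  obtain ⟨I'', k', ⟨eN⟩⟩ := aux_summand (fun i => G i) hloc hfg
    (e.symm.toLinearMap ∘ₗ P.toLinearMap ∘ₗ LinearMap.inr R L N)
    (LinearMap.snd R L N ∘ₗ P.symm.toLinearMap ∘ₗ e.toLinearMap) (fun x => by
      simp only [LinearMap.comp_apply, LinearEquiv.coe_coe, LinearEquiv.apply_symm_apply,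
        LinearEquiv.symm_apply_apply]; rfl)
  obtain ⟨Lf, hL, hL'⟩ := aux_internal (fun a => G (k a)) eL
  obtain ⟨Nf, hN, hN'⟩ := aux_internal (fun a => G (k' a)) eN
  refine ⟨I', I'', Lf, Nf, by convert hL, by convert hN, fun j => ⟨_, hL' j⟩, fun j => ⟨_, hN' j⟩, ?_⟩
  intro G₀ _ _ hG₀
  obtain ⟨es⟩ := aux_sum (R := R) (fun i => G i) k k'
  rw [aux_count (fun i => G i) (fun x => G (Sum.elim k k' x)) hloc (fun _ => hloc _) hfg
    (fun _ => hfg _) ((e.trans P.symm).trans ((LinearEquiv.prodCongr eL eN).trans es)) G₀ hG₀]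
  rw [Cardinal.mk_congr (Equiv.subtypeSum), Cardinal.mk_sum, Cardinal.lift_id, Cardinal.lift_id]
  congr 1
  · refine Cardinal.mk_congr (Equiv.subtypeEquivRight fun j => ?_)
    exact ⟨fun h => ⟨(hL' j).some.trans h.some⟩, fun h => ⟨(hL' j).some.symm.trans h.some⟩⟩
  · refine Cardinal.mk_congr (Equiv.subtypeEquivRight fun j => ?_)
    exact ⟨fun h => ⟨(hN' j).some.trans h.some⟩, fun h => ⟨(hN' j).some.symm.trans h.some⟩⟩
end

section
/- Let R be a ring, B a left R-module, (M_i)_{i ∈ I} a family of left R-modules, and n ≥ 0. Then there is an isomorphism of abelian groups Ext^n_R(⊕_{i ∈ I} M_i, B) ≅ ∏_{i ∈ I} Ext^n_R(M_i, B). -/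
open CategoryTheory DirectSum

universe u v w

namespace ExtSum

/-- Homology of a jointly bijective family of projections of short complexes. -/
theorem homology_pi {A : Type v} [Ring A] {I : Type w} (S : ShortComplex (ModuleCat.{u} A))
    (T : I → ShortComplex (ModuleCat.{u} A)) (p : ∀ i, S ⟶ T i)
    (h1 : ∀ y : ∀ i, (T i).X₁, ∃ x : S.X₁, ∀ i, (p i).τ₁.hom x = y i)
    (h2 : ∀ y : ∀ i, (T i).X₂, ∃ x : S.X₂, ∀ i, (p i).τ₂.hom x = y i)
    (h2' : ∀ x : S.X₂, (∀ i, (p i).τ₂.hom x = 0) → x = 0)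
    (h3 : ∀ x : S.X₃, (∀ i, (p i).τ₃.hom x = 0) → x = 0) :
    Nonempty (S.homology ≃+ ∀ i, (T i).homology) := by
  have c12 : ∀ i (x : S.X₁), (T i).f.hom ((p i).τ₁.hom x) = (p i).τ₂.hom (S.f.hom x) :=
    fun i x => congr($((p i).comm₁₂).hom x)
  have c23 : ∀ i (x : S.X₂), (T i).g.hom ((p i).τ₂.hom x) = (p i).τ₃.hom (S.g.hom x) :=
    fun i x => congr($((p i).comm₂₃).hom x)
  let q : ∀ i, LinearMap.ker S.g.hom →ₗ[A] LinearMap.ker (T i).g.hom := fun i =>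
    ((p i).τ₂.hom.comp (LinearMap.ker S.g.hom).subtype).codRestrict _ (fun x => by
      have hx : S.g.hom x.1 = 0 := x.2
      simp only [LinearMap.mem_ker, LinearMap.comp_apply, Submodule.subtype_apply]
      rw [c23, hx, map_zero])
  let φ : LinearMap.ker S.g.hom →ₗ[A]
      ∀ i, (LinearMap.ker (T i).g.hom ⧸ LinearMap.range (T i).moduleCatToCycles) :=
    LinearMap.pi fun i => (Submodule.mkQ _).comp (q i)
  have hs : Function.Surjective φ := by
    intro y
    choose z hz using fun i => Submodule.mkQ_surjective _ (y i)
    obtain ⟨x, hx⟩ := h2 (fun i => (z i).1)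
    have hxk : S.g.hom x = 0 := h3 _ fun i => by
      rw [← c23, hx]
      exact (z i).2
    refine ⟨⟨x, hxk⟩, ?_⟩
    funext i
    rw [← hz]
    change Submodule.mkQ _ (q i ⟨x, hxk⟩) = _
    congr 1
    exact Subtype.ext (hx i)
  have hk : LinearMap.range S.moduleCatToCycles = LinearMap.ker φ := by
    ext x
    constructor
    · rintro ⟨a, rfl⟩
      rw [LinearMap.mem_ker]
      funext i
      change Submodule.mkQ _ (q i _) = 0
      rw [Submodule.mkQ_apply, Submodule.Quotient.mk_eq_zero]
      exact ⟨(p i).τ₁.hom a, Subtype.ext (c12 i a)⟩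
    · intro hx
      have hx' : ∀ i, ∃ b, (T i).moduleCatToCycles b = q i x := fun i => by
        have := congrFun (LinearMap.mem_ker.1 hx) i
        change Submodule.mkQ _ (q i _) = 0 at this
        rw [Submodule.mkQ_apply, Submodule.Quotient.mk_eq_zero] at this
        exact this
      choose b hb using hx'
      obtain ⟨a, ha⟩ := h1 b
      refine ⟨a, Subtype.ext ?_⟩
      change S.f.hom a = x.1
      rw [← sub_eq_zero]
      refine h2' _ fun i => ?_
      rw [map_sub, ← c12, ha, sub_eq_zero]
      exact congrArg Subtype.val (hb i)
  let e1 : S.homology ≃ₗ[A] (LinearMap.ker S.g.hom ⧸ LinearMap.range S.moduleCatToCycles) :=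
    S.moduleCatHomologyIso.toLinearEquiv
  let e2 : ∀ i, (T i).homology ≃ₗ[A]
      (LinearMap.ker (T i).g.hom ⧸ LinearMap.range (T i).moduleCatToCycles) :=
    fun i => (T i).moduleCatHomologyIso.toLinearEquiv
  exact ⟨(e1.trans ((Submodule.quotEquivOfEq _ _ hk).trans
    ((φ.quotKerEquivOfSurjective hs).trans
      (LinearEquiv.piCongrRight fun i => (e2 i).symm)))).toAddEquiv⟩

theorem lmap_exact {R : Type u} [Ring R] {I : Type u} {X Y Z : I → Type u}
    [∀ i, AddCommGroup (X i)] [∀ i, Module R (X i)]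
    [∀ i, AddCommGroup (Y i)] [∀ i, Module R (Y i)]
    [∀ i, AddCommGroup (Z i)] [∀ i, Module R (Z i)]
    (f : ∀ i, X i →ₗ[R] Y i) (g : ∀ i, Y i →ₗ[R] Z i)
    (h : ∀ i, Function.Exact (f i) (g i)) :
    Function.Exact (DirectSum.lmap f) (DirectSum.lmap g) := by
  classical
  intro y
  constructor
  · intro hy
    have hy' : ∀ i, ∃ x, f i x = y i := fun i =>
      (h i _).1 (by rw [← DirectSum.lmap_apply, hy]; rfl)
    choose x hx using hy'
    refine ⟨DFinsupp.mk y.support (fun i => x i), ?_⟩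
    refine DFinsupp.ext fun i => ?_
    change f i (DFinsupp.mk y.support (fun i => x i) i) = y i
    rw [DFinsupp.mk_apply]
    split_ifs with hi
    · exact hx i
    · rw [map_zero]
      exact (DFinsupp.notMem_support_iff.1 hi).symm
  · rintro ⟨x, rfl⟩
    refine DFinsupp.ext fun i => ?_
    exact (h i).apply_apply_eq_zero (x i)

section

variable {R : Type u} [Ring R] {I : Type u}

/-- Degreewise direct sum of chain complexes. -/
noncomputable def sumComplex (K : I → ChainComplex (ModuleCat.{u} R) ℕ) :
    ChainComplex (ModuleCat.{u} R) ℕ where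
  X n := ModuleCat.of R (⨁ i, (K i).X n)
  d m n := ModuleCat.ofHom (DirectSum.lmap fun i => ((K i).d m n).hom)
  shape m n h := by
    refine ModuleCat.hom_ext (LinearMap.ext fun x => ?_)
    refine DFinsupp.ext fun i => ?_
    change ((K i).d m n).hom (x i) = 0
    rw [(K i).shape m n h]
    rfl
  d_comp_d' l m n _ _ := by
    refine ModuleCat.hom_ext (LinearMap.ext fun x => ?_)
    refine DFinsupp.ext fun i => ?_
    change ((K i).d m n).hom (((K i).d l m).hom (x i)) = 0
    exact congr($((K i).d_comp_d l m n).hom (x i))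

variable {M : I → ModuleCat.{u} R} (P : ∀ i, ProjectiveResolution (M i))

/-- The augmentation in degree zero. -/
noncomputable def aug : (sumComplex fun i => (P i).complex).X 0 ⟶ ModuleCat.of R (⨁ i, M i) :=
  ModuleCat.ofHom (DirectSum.lmap fun i =>
    (show (P i).complex.X 0 ⟶ M i from (P i).π.f 0).hom)

theorem d_aug : (sumComplex fun i => (P i).complex).d 1 0 ≫ aug P = 0 := by
  refine ModuleCat.hom_ext (LinearMap.ext fun x => ?_)
  refine DFinsupp.ext fun i => ?_
  exact congr($((P i).complex_d_comp_π_f_zero).hom ((show ⨁ i, (P i).complex.X 1 from x) i))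

theorem exact_aug : (ShortComplex.mk _ _ (d_aug P)).Exact := by
  rw [ShortComplex.ShortExact.moduleCat_exact_iff_function_exact]
  exact lmap_exact _ _ fun i =>
    (ShortComplex.ShortExact.moduleCat_exact_iff_function_exact _).1 (P i).exact₀

theorem epi_aug : Epi (aug P) := by
  rw [ModuleCat.epi_iff_surjective]
  refine (DirectSum.lmap_surjective _).2 fun i => ?_
  exact (ModuleCat.epi_iff_surjective ((P i).π.f 0)).1 inferInstance

theorem exactAt_succ (n : ℕ) : (sumComplex fun i => (P i).complex).ExactAt (n + 1) := by
  rw [HomologicalComplex.exactAt_iff' _ (n + 2) (n + 1) n (by simp) (by simp),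
    ShortComplex.ShortExact.moduleCat_exact_iff_function_exact]
  exact lmap_exact _ _ fun i =>
    (ShortComplex.ShortExact.moduleCat_exact_iff_function_exact _).1 ((P i).exact_succ n)

theorem proj (n : ℕ) : Projective ((sumComplex fun i => (P i).complex).X n) := by
  have : ∀ i, Module.Projective R ((P i).complex.X n) := fun i =>
    (IsProjective.iff_projective _).2 ((P i).projective n)
  exact (IsProjective.iff_projective (⨁ i, (P i).complex.X n)).1 inferInstance

/-- Direct sum of projective resolutions. -/
noncomputable def sumRes : ProjectiveResolution (ModuleCat.of R (⨁ i, M i)) where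
  complex := sumComplex fun i => (P i).complex
  projective := proj P
  π := (ChainComplex.toSingle₀Equiv _ _).symm ⟨aug P, d_aug P⟩
  quasiIso := ⟨fun n => by
    cases n
    · rw [ChainComplex.quasiIsoAt₀_iff, ShortComplex.quasiIso_iff_of_zeros']
      · refine (ShortComplex.exact_and_epi_g_iff_of_iso ?_).2
          ⟨exact_aug P, epi_aug P⟩
        exact ShortComplex.isoMk (Iso.refl _) (Iso.refl _) (Iso.refl _)
          ((Category.id_comp _).trans (Category.comp_id _).symm)
          (by
            simp
            exact (Category.id_comp (aug P)).trans (Category.comp_id (aug P)).symm)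
      · exact (sumComplex fun i => (P i).complex).shape 0 0 (by simp)
      all_goals rfl
    · rw [quasiIsoAt_iff_exactAt']
      · apply exactAt_succ
      · apply ChainComplex.exactAt_succ_single_obj⟩

open Classical in
/-- The restriction maps on Hom complexes. -/
noncomputable def res (K : I → ChainComplex (ModuleCat.{u} R) ℕ) (B : ModuleCat.{u} R) (i : I) :
    (sumComplex K).linearYonedaObj ℤ B ⟶ (K i).linearYonedaObj ℤ B where
  f n := ((linearYoneda ℤ (ModuleCat.{u} R)).obj B).map
    (show (K i).X n ⟶ (sumComplex K).X n from
      ModuleCat.ofHom (DirectSum.lof R I (fun i => (K i).X n) i)).op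
  comm' m n _ := by
    refine ModuleCat.hom_ext (LinearMap.ext fun g => ?_)
    refine ModuleCat.hom_ext (LinearMap.ext fun x => ?_)
    change g.hom (DirectSum.lof R I (fun i => (K i).X m) i (((K i).d n m).hom x)) =
      g.hom (DirectSum.lmap (fun i => ((K i).d n m).hom)
        (DirectSum.lof R I (fun i => (K i).X n) i x))
    rw [DirectSum.lmap_lof]

theorem res_surj (K : I → ChainComplex (ModuleCat.{u} R) ℕ) (B : ModuleCat.{u} R) (n : ℕ)
    (y : ∀ i, ((K i).linearYonedaObj ℤ B).X n) :
    ∃ x : ((sumComplex K).linearYonedaObj ℤ B).X n, ∀ i, ((res K B i).f n).hom x = y i := by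
  classical
  let y' : ∀ i, (K i).X n ⟶ B := y
  refine ⟨(ModuleCat.ofHom (DirectSum.toModule R I B fun i => (y' i).hom) :
    ModuleCat.of R (⨁ i, (K i).X n) ⟶ B), fun i => ?_⟩
  refine ModuleCat.hom_ext (LinearMap.ext fun x => ?_)
  refine Eq.trans ?_ (DirectSum.toModule_lof R (φ := fun i => (y' i).hom) i x)
  simp only [res]
  change DirectSum.toModule R I B (fun i => (y' i).hom) (DirectSum.lof R I _ i x) = _
  congr!

theorem res_inj (K : I → ChainComplex (ModuleCat.{u} R) ℕ) (B : ModuleCat.{u} R) (n : ℕ)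
    (x : ((sumComplex K).linearYonedaObj ℤ B).X n)
    (h : ∀ i, ((res K B i).f n).hom x = 0) : x = 0 := by
  classical
  let x' : ModuleCat.of R (⨁ i, (K i).X n) ⟶ B := x
  change x' = 0
  refine ModuleCat.hom_ext (DirectSum.linearMap_ext R fun i => LinearMap.ext fun a => ?_)
  have := congrArg (fun g : (K i).X n ⟶ B => g.hom a) (h i)
  refine Eq.trans ?_ this
  change x'.hom _ = x'.hom _
  congr!

end

end ExtSum

/-- `Ext^n(⨁ᵢ Mᵢ, B) ≅ ∏ᵢ Ext^n(Mᵢ, B)` as abelian groups. -/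
theorem ext_directSum_fst {R : Type u} [Ring R] {I : Type u}
    (M : I → Type u) [∀ i, AddCommGroup (M i)] [∀ i, Module R (M i)]
    (B : Type u) [AddCommGroup B] [Module R B] (n : ℕ) :
    Nonempty
      ((((Ext ℤ (ModuleCat.{u} R) n).obj
          (Opposite.op (ModuleCat.of R (⨁ i : I, M i)))).obj (ModuleCat.of R B)) ≃+
        ∀ i : I, (((Ext ℤ (ModuleCat.{u} R) n).obj
          (Opposite.op (ModuleCat.of R (M i)))).obj (ModuleCat.of R B))) := by
  let P : ∀ i, ProjectiveResolution (ModuleCat.of R (M i)) := fun i => projectiveResolution _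
  let Q : ProjectiveResolution (ModuleCat.of R (⨁ i, M i)) := ExtSum.sumRes P
  let K : I → ChainComplex (ModuleCat.{u} R) ℕ := fun i => (P i).complex
  obtain ⟨e⟩ := ExtSum.homology_pi
    (((ExtSum.sumComplex K).linearYonedaObj ℤ (ModuleCat.of R B)).sc n)
    (fun i => ((K i).linearYonedaObj ℤ (ModuleCat.of R B)).sc n)
    (fun i => (HomologicalComplex.shortComplexFunctor _ _ n).map
      (ExtSum.res K (ModuleCat.of R B) i))
    (ExtSum.res_surj K _ _) (ExtSum.res_surj K _ _) (ExtSum.res_inj K _ _)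
    (ExtSum.res_inj K _ _)
  exact ⟨((Q.isoExt (R := ℤ) n (ModuleCat.of R B)).toLinearEquiv.toAddEquiv.trans e).trans
    (AddEquiv.piCongrRight fun i =>
      ((P i).isoExt (R := ℤ) n (ModuleCat.of R B)).toLinearEquiv.toAddEquiv.symm)⟩
end

section
/- Let R be a left Noetherian ring, (A_i)_{i ∈ I} a family of finitely generated left R-modules, (B_j)_{j ∈ J} a family of left R-modules, (S_i)_{i ∈ I} and (T_j)_{j ∈ J} arbitrary families of index sets, and n ≥ 0. If Ext^n_R(A_i, B_j) = 0 for every i ∈ I and every j ∈ J, then Ext^n_R(⊕_{i ∈ I} A_i^(S_i), ⊕_{j ∈ J} B_j^(T_j)) = 0. -/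
open CategoryTheory DirectSum

universe u v w

theorem old_ext_iff {R : Type u} [Ring R] (X Y : ModuleCat.{u} R) (n : ℕ) :
    Subsingleton ((((Ext ℤ (ModuleCat.{u} R) n).obj (Opposite.op X)).obj Y)) ↔
      Subsingleton (Abelian.Ext.{u} X Y n) := by
  let P : ProjectiveResolution X := ProjectiveResolution.of X
  have h1 : Subsingleton ((((Ext ℤ (ModuleCat.{u} R) n).obj (Opposite.op X)).obj Y)) ↔
      (P.complex.linearYonedaObj ℤ Y).ExactAt n := by
    rw [HomologicalComplex.exactAt_iff_isZero_homology, ← (P.isoExt n Y).isZero_iff]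
    exact ⟨fun _ => ModuleCat.isZero_of_subsingleton _,
      fun h => ModuleCat.subsingleton_of_isZero h⟩
  rw [h1]
  cases n with
  | zero =>
    rw [HomologicalComplex.exactAt_iff' _ 0 0 1 (by simp) (by simp),
      ShortComplex.moduleCat_exact_iff]
    constructor
    · intro h
      refine ⟨fun a b => ?_⟩
      suffices H : ∀ a : Abelian.Ext.{u} X Y 0, a = 0 by rw [H a, H b]
      intro a
      obtain ⟨f, hf, rfl⟩ := P.extMk_surjective a 1 rfl
      obtain ⟨g, hg⟩ := h f hf
      have : f = 0 := by
        rw [← hg]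
        change (P.complex.d 0 0 ≫ (show P.complex.X 0 ⟶ Y from g)) = 0
        rw [P.complex.shape 0 0 (by simp), Limits.zero_comp]
      subst this
      exact P.extMk_zero _ _
    · intro h f hf
      refine ⟨0, ?_⟩
      rw [map_zero]
      have hf' : P.complex.d 1 0 ≫ (show P.complex.X 0 ⟶ Y from f) = 0 := hf
      obtain ⟨l, hl⟩ := Limits.CokernelCofork.IsColimit.desc' P.isColimitCokernelCofork _ hf'
      have : l = 0 := (Abelian.Ext.mk₀_bijective _ _).1 (h.elim _ _)
      rw [this, Limits.comp_zero] at hl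
      exact hl
  | succ p =>
    rw [HomologicalComplex.exactAt_iff' _ p (p+1) (p+2) (by simp) (by simp),
      ShortComplex.moduleCat_exact_iff]
    constructor
    · intro h
      refine ⟨fun a b => ?_⟩
      suffices H : ∀ a : Abelian.Ext.{u} X Y (p+1), a = 0 by rw [H a, H b]
      intro a
      obtain ⟨f, hf, rfl⟩ := P.extMk_surjective a (p+2) rfl
      obtain ⟨g, hg⟩ := h f hf
      rw [P.extMk_eq_zero_iff _ _ _ _ p rfl]
      exact ⟨g, hg⟩
    · intro h f hf
      obtain ⟨g, hg⟩ := (P.extMk_eq_zero_iff f (p+2) rfl hf p rfl).1 (h.elim _ _)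
      exact ⟨g, hg⟩

/-- Vanishing in the first variable. -/
theorem ext_left {R : Type u} [Ring R] {K : Type w} (X Y : ModuleCat.{u} R)
    (A : K → ModuleCat.{u} R) (i : ∀ k, A k ⟶ X)
    (hdesc : ∀ (Z : ModuleCat.{u} R) (f : ∀ k, A k ⟶ Z), ∃ g : X ⟶ Z, ∀ k, i k ≫ g = f k)
    (hext : ∀ (Z : ModuleCat.{u} R) (f g : X ⟶ Z), (∀ k, i k ≫ f = i k ≫ g) → f = g)
    (n : ℕ) (h : ∀ k, Subsingleton (Abelian.Ext.{u} (A k) Y n)) :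
    Subsingleton (Abelian.Ext.{u} X Y n) := by
  refine ⟨fun a b => ?_⟩
  suffices H : ∀ a : Abelian.Ext.{u} X Y n, a = 0 by rw [H a, H b]
  intro a
  cases n with
  | zero =>
    obtain ⟨f, rfl⟩ := (Abelian.Ext.mk₀_bijective _ _).2 a
    have : f = 0 := hext _ _ _ fun k =>
      (Abelian.Ext.mk₀_bijective _ _).1 ((h k).elim _ _)
    rw [this, Abelian.Ext.mk₀_zero]
  | succ p =>
    let Q : InjectiveResolution Y := InjectiveResolution.of Y
    obtain ⟨f, hf, rfl⟩ := Q.extMk_surjective a (p+2) rfl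
    rw [Q.extMk_eq_zero_iff _ _ _ _ p rfl]
    have (k : K) : ∃ g, g ≫ Q.cocomplex.d p (p+1) = i k ≫ f :=
      (Q.extMk_eq_zero_iff (i k ≫ f) (p+2) rfl (by simp [hf]) p rfl).1 ((h k).elim _ _)
    choose g hg using this
    obtain ⟨G, hG⟩ := hdesc _ g
    exact ⟨G, hext _ _ _ fun k => by rw [← hg, ← hG, Category.assoc]⟩

theorem ext_fin {R : Type u} [Ring R] [IsNoetherianRing R] {K : Type w} (X Y : ModuleCat.{u} R)
    [Module.Finite R X]
    (B : K → ModuleCat.{u} R) (i : ∀ k, B k ⟶ Y) (p : ∀ k, Y ⟶ B k)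
    (hY : ∀ y : Y, ∃ F : Finset K, ∀ F', F ⊆ F' → ∑ k ∈ F', (p k ≫ i k) y = y)
    (n : ℕ) (a : Abelian.Ext.{u} X Y n) :
    ∃ F : Finset K, a = a.comp (Abelian.Ext.mk₀ (∑ k ∈ F, p k ≫ i k)) (add_zero n) := by
  classical
  induction n generalizing X with
  | zero =>
    obtain ⟨f, rfl⟩ := (Abelian.Ext.mk₀_bijective _ _).2 a
    obtain ⟨s, hs⟩ := Module.Finite.fg_top (R := R) (M := X)
    choose F hF using hY
    refine ⟨s.biUnion fun x => F (f x), ?_⟩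
    rw [Abelian.Ext.mk₀_comp_mk₀]
    congr 1
    ext1
    refine LinearMap.ext_on hs fun x hx => ?_
    have := hF (f x) (s.biUnion fun x => F (f x)) (Finset.subset_biUnion_of_mem (fun x => F (f x)) hx)
    rw [ModuleCat.hom_comp, ModuleCat.hom_sum]
    simpa using this.symm
  | succ n ih =>
    obtain ⟨m, f, surjf⟩ := Module.Finite.exists_fin' R X
    have exac := LinearMap.shortExact_shortComplexKer surjf
    obtain ⟨b, hb⟩ := precomp_extClass_surjective_of_projective_X₂ Y exac n a
    have : Module.Finite R f.shortComplexKer.X₁ :=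
      inferInstanceAs (Module.Finite R (LinearMap.ker f))
    obtain ⟨F, hF⟩ := ih _ b
    refine ⟨F, ?_⟩
    rw [← hb]
    change exac.extClass.comp b (add_comm 1 n) = (exac.extClass.comp b (add_comm 1 n)).comp _ _
    rw [Abelian.Ext.comp_assoc_of_third_deg_zero, ← hF]

theorem ext_right {R : Type u} [Ring R] [IsNoetherianRing R] {K : Type w} (X Y : ModuleCat.{u} R)
    [Module.Finite R X]
    (B : K → ModuleCat.{u} R) (i : ∀ k, B k ⟶ Y) (p : ∀ k, Y ⟶ B k)
    (hY : ∀ y : Y, ∃ F : Finset K, ∀ F', F ⊆ F' → ∑ k ∈ F', (p k ≫ i k) y = y)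
    (n : ℕ) (h : ∀ k, Subsingleton (Abelian.Ext.{u} X (B k) n)) :
    Subsingleton (Abelian.Ext.{u} X Y n) := by
  classical
  refine ⟨fun a b => ?_⟩
  suffices H : ∀ a : Abelian.Ext.{u} X Y n, a = 0 by rw [H a, H b]
  intro a
  obtain ⟨F, hF⟩ := ext_fin X Y B i p hY n a
  rw [hF]
  clear hF
  induction F using Finset.induction_on with
  | empty => simp
  | insert k s hk ih =>
    rw [Finset.sum_insert hk, Abelian.Ext.mk₀_add, Abelian.Ext.comp_add, ih, add_zero,
      ← Abelian.Ext.mk₀_comp_mk₀, ← Abelian.Ext.comp_assoc_of_third_deg_zero,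
      (h k).elim (a.comp (Abelian.Ext.mk₀ (p k)) (add_zero n)) 0, Abelian.Ext.zero_comp]

theorem ext_directSum_vanishing {R : Type u} [Ring R] [IsNoetherianRing R]
    {I : Type u} {J : Type u}
    (A : I → Type u) [∀ i, AddCommGroup (A i)] [∀ i, Module R (A i)]
    (B : J → Type u) [∀ j, AddCommGroup (B j)] [∀ j, Module R (B j)]
    (hA : ∀ i, Module.Finite R (A i))
    (S : I → Type u) (T : J → Type u) (n : ℕ)
    (hvanish : ∀ i j, Subsingleton
      ((((Ext ℤ (ModuleCat.{u} R) n).obj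
        (Opposite.op (ModuleCat.of R (A i)))).obj (ModuleCat.of R (B j))))) :
    Subsingleton
      ((((Ext ℤ (ModuleCat.{u} R) n).obj
        (Opposite.op (ModuleCat.of R (⨁ i : I, (S i →₀ A i))))).obj
          (ModuleCat.of R (⨁ j : J, (T j →₀ B j))))) := by
  classical
  simp only [old_ext_iff] at hvanish ⊢
  refine ext_left _ _ (fun i => ModuleCat.of R (S i →₀ A i))
    (fun i => ModuleCat.ofHom (DirectSum.lof R I (fun i => S i →₀ A i) i))
    (fun Z f => ⟨ModuleCat.ofHom (DirectSum.toModule R I Z fun i => (f i).hom), fun k => ?_⟩)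
    (fun Z f g h => ?_) n fun i => ?_
  · ext1
    refine LinearMap.ext fun x => ?_
    exact DirectSum.toModule_lof (M := fun i => S i →₀ A i) (N := Z) (φ := fun i => (f i).hom) R k x
  · ext1
    exact DirectSum.linearMap_ext R fun k => congrArg ModuleCat.Hom.hom (h k)
  refine ext_left _ _ (fun _ : S i => ModuleCat.of R (A i))
    (fun s => ModuleCat.ofHom (Finsupp.lsingle s))
    (fun Z f => ⟨ModuleCat.ofHom (Finsupp.lsum ℕ fun s => (f s).hom), fun k => ?_⟩)
    (fun Z f g h => ?_) n fun _ => ?_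
  · ext1
    refine LinearMap.ext fun x => ?_
    simp
  · ext1
    exact Finsupp.lhom_ext' fun k => congrArg ModuleCat.Hom.hom (h k)
  have := hA i
  refine ext_right _ _ (fun j => ModuleCat.of R (T j →₀ B j))
    (fun j => ModuleCat.ofHom (DirectSum.lof R J (fun j => T j →₀ B j) j))
    (fun j => ModuleCat.ofHom (DirectSum.component R J (fun j => T j →₀ B j) j))
    (fun y => ⟨DFinsupp.support y, fun F' hF => ?_⟩) n fun j => ?_
  · change ∑ k ∈ F', DirectSum.lof R J (fun j => T j →₀ B j) k (y k) = y
    rw [← Finset.sum_subset hF]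
    · exact DirectSum.sum_support_of y
    · intro x _ hx
      rw [DFinsupp.notMem_support_iff.1 hx, map_zero]
  refine ext_right _ _ (fun _ : T j => ModuleCat.of R (B j))
    (fun t => ModuleCat.ofHom (Finsupp.lsingle t))
    (fun t => ModuleCat.ofHom (Finsupp.lapply t))
    (fun y => ⟨Finsupp.support y, fun F' hF => ?_⟩) n fun _ => hvanish i j
  change ∑ k ∈ F', Finsupp.single k (y k) = y
  rw [← Finset.sum_subset hF]
  · exact Finsupp.sum_single y
  · intro x _ hx
    rw [Finsupp.notMem_support_iff.1 hx, Finsupp.single_zero]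
end

section
/- Let (Δ; Ω, ≤) be a b-homological system over R, let M be a left R-module, and let F be a Δ̃-filtration of M. Then there exists a slim Δ̃-filtration F̲ of M refining F (every submodule occurring in F occurs in F̲) such that ℓ_ω(F) = ℓ_ω(F̲) for every ω ∈ Ω. -/
open CategoryTheory DirectSum

universe u v w

variable {R : Type u} [Ring R] {Ω : Type u} [Preorder Ω]

/-- A `Δ̃`-filtration of the `R`-module `M`: a finite strictly increasing chain of submodules from
`⊥` to `⊤` whose successive quotients are direct sums `⨁_ω Δ_ω^(I_ω)` with finitely many of the
(arbitrary) index sets `I_ω` nonempty. -/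
structure BHomSystem.TildeFiltration (S : BHomSystem R Ω) (M : Type u)
    [AddCommGroup M] [Module R M] : Type (max u (w + 1)) where
  len : ℕ
  W : Fin (len + 1) → Submodule R M
  strictMono : StrictMono W
  bot : W 0 = ⊥
  top : W (Fin.last len) = ⊤
  idx : Fin len → Ω → Type w
  finSupp : ∀ i, {ω : Ω | Nonempty (idx i ω)}.Finite
  iso : ∀ i : Fin len,
    Nonempty ((↥(W i.succ) ⧸ (Submodule.comap (W i.succ).subtype (W i.castSucc))) ≃ₗ[R]
      (⨁ ω : Ω, (idx i ω →₀ S.Δ ω)))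

/-- `ℓ_ω(F)`: the cardinal number of copies of `Δ_ω` appearing in the `Δ̃`-filtration `F`. -/
noncomputable def BHomSystem.TildeFiltration.mult {S : BHomSystem R Ω} {M : Type u}
    [AddCommGroup M] [Module R M] (F : S.TildeFiltration M) (ω : Ω) : Cardinal.{w} :=
  ∑ i : Fin F.len, Cardinal.mk (F.idx i ω)

/-- A slim `Δ̃`-filtration of `M`: a finite strictly increasing chain of submodules from `⊥` to
`⊤` whose successive quotients are direct sums of copies of a single `Δ_ω`. -/
structure BHomSystem.SlimFiltration (S : BHomSystem R Ω) (M : Type u)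
    [AddCommGroup M] [Module R M] : Type (max u (w + 1)) where
  len : ℕ
  W : Fin (len + 1) → Submodule R M
  strictMono : StrictMono W
  bot : W 0 = ⊥
  top : W (Fin.last len) = ⊤
  lay : Fin len → Ω
  idx : Fin len → Type w
  iso : ∀ i : Fin len,
    Nonempty ((↥(W i.succ) ⧸ (Submodule.comap (W i.succ).subtype (W i.castSucc))) ≃ₗ[R]
      (idx i →₀ S.Δ (lay i)))

open Classical in
/-- `ℓ_ω(F)` for a slim `Δ̃`-filtration: the cardinal sum, over the layers `j` with `ω_j = ω`,
of the cardinalities of the index sets. -/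
noncomputable def BHomSystem.SlimFiltration.mult {S : BHomSystem R Ω} {M : Type u}
    [AddCommGroup M] [Module R M] (F : S.SlimFiltration M) (ω : Ω) : Cardinal.{w} :=
  ∑ i : Fin F.len, if F.lay i = ω then Cardinal.mk (F.idx i) else 0

section Aux

/-- The quotient `B / A` is a direct sum of `I` copies of `Δ ω`. -/
def SlimQ (S : BHomSystem R Ω) {M : Type u} [AddCommGroup M] [Module R M]
    (A B : Submodule R M) (I : Type w) (ω : Ω) : Prop :=
  Nonempty ((↥B ⧸ (Submodule.comap B.subtype A)) ≃ₗ[R] (I →₀ S.Δ ω))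

open Classical in
/-- Partial slim filtrations up to `A`. -/
def SlimPart (S : BHomSystem R Ω) {M : Type u} [AddCommGroup M] [Module R M]
    (A : Submodule R M) (m : Ω → Cardinal.{w}) (T : Set (Submodule R M)) : Prop :=
  ∃ (len : ℕ) (W : Fin (len + 1) → Submodule R M) (lay : Fin len → Ω) (idx : Fin len → Type w),
    StrictMono W ∧ W 0 = ⊥ ∧ W (Fin.last len) = A ∧
    (∀ i : Fin len, SlimQ S (W i.castSucc) (W i.succ) (idx i) (lay i)) ∧
    (∀ ω, m ω = ∑ i : Fin len, if lay i = ω then Cardinal.mk (idx i) else 0) ∧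
    T ⊆ Set.range W

theorem SlimPart.zero (S : BHomSystem R Ω) {M : Type u} [AddCommGroup M] [Module R M] :
    SlimPart.{u, w} S (⊥ : Submodule R M) (fun _ => 0) {⊥} := by
  refine ⟨0, fun _ => ⊥, Fin.elim0, Fin.elim0, ?_, rfl, rfl, fun i => i.elim0, by simp, by simp⟩
  intro a b h
  exact absurd h (by omega)

open Classical in
theorem SlimPart.step {S : BHomSystem R Ω} {M : Type u} [AddCommGroup M] [Module R M]
    {A B : Submodule R M} {m : Ω → Cardinal.{w}} {T : Set (Submodule R M)}
    (h : SlimPart S A m T) (hAB : A < B) {I : Type w} {a : Ω} (hq : SlimQ S A B I a) :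
    SlimPart S B (fun ω => m ω + if a = ω then Cardinal.mk I else 0) (insert B T) := by
  obtain ⟨n, W, lay, idx, h1, h2, h3, h4, h5, h6⟩ := h
  refine ⟨n + 1, Fin.snoc (α := fun _ => Submodule R M) W B,
    Fin.snoc (α := fun _ => Ω) lay a, Fin.snoc (α := fun _ => Type w) idx I, ?_, ?_, ?_, ?_, ?_, ?_⟩
  · rw [Fin.strictMono_iff_lt_succ]
    intro i
    refine Fin.lastCases ?_ (fun i => ?_) i
    · rw [Fin.snoc_castSucc, Fin.succ_last, Fin.snoc_last, h3]
      exact hAB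
    · rw [Fin.snoc_castSucc, Fin.succ_castSucc, Fin.snoc_castSucc]
      exact h1 Fin.castSucc_lt_succ
  · rw [← Fin.castSucc_zero, Fin.snoc_castSucc, h2]
  · rw [Fin.snoc_last]
  · intro i
    refine Fin.lastCases ?_ (fun i => ?_) i
    · rw [Fin.snoc_castSucc, Fin.succ_last, Fin.snoc_last, Fin.snoc_last, Fin.snoc_last, h3]
      exact hq
    · rw [Fin.snoc_castSucc, Fin.succ_castSucc, Fin.snoc_castSucc, Fin.snoc_castSucc,
        Fin.snoc_castSucc]
      exact h4 i
  · intro ω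
    rw [Fin.sum_univ_castSucc]
    simp only [Fin.snoc_castSucc, Fin.snoc_last, h5]
  · rintro X (rfl | hX)
    · exact ⟨Fin.last _, Fin.snoc_last (α := fun _ => Submodule R M) _ _⟩
    · obtain ⟨j, rfl⟩ := h6 hX
      exact ⟨j.castSucc, Fin.snoc_castSucc (α := fun _ => Submodule R M) _ _ _⟩

theorem SlimPart.mono {S : BHomSystem R Ω} {M : Type u} [AddCommGroup M] [Module R M]
    {A : Submodule R M} {m : Ω → Cardinal.{w}} {T T' : Set (Submodule R M)}
    (h : SlimPart S A m T) (hT : T' ⊆ T) : SlimPart S A m T' := by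
  obtain ⟨n, W, lay, idx, h1, h2, h3, h4, h5, h6⟩ := h
  exact ⟨n, W, lay, idx, h1, h2, h3, h4, h5, hT.trans h6⟩

/-- The submodule of elements of `B` whose image has support in `s`. -/
def suppSub (S : BHomSystem R Ω) {M : Type u} [AddCommGroup M] [Module R M]
    (B : Submodule R M) (idx : Ω → Type w) (q : B →ₗ[R] (⨁ ω : Ω, (idx ω →₀ S.Δ ω)))
    (s : Set Ω) : Submodule R M :=
  Submodule.map B.subtype
    { carrier := {x | ∀ ω, ω ∉ s → q x ω = 0}
      add_mem' := by
        intro x y hx hy ω hω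
        rw [map_add, DirectSum.add_apply, hx ω hω, hy ω hω, add_zero]
      zero_mem' := by
        intro ω _
        rw [map_zero, DirectSum.zero_apply]
      smul_mem' := by
        intro c x hx ω hω
        rw [map_smul, DirectSum.smul_apply, hx ω hω, smul_zero] }

theorem mem_suppSub (S : BHomSystem R Ω) {M : Type u} [AddCommGroup M] [Module R M]
    (B : Submodule R M) (idx : Ω → Type w) (q : B →ₗ[R] (⨁ ω : Ω, (idx ω →₀ S.Δ ω)))
    (s : Set Ω) (x : M) :
    x ∈ suppSub S B idx q s ↔ ∃ h : x ∈ B, ∀ ω, ω ∉ s → q ⟨x, h⟩ ω = 0 := by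
  constructor
  · rintro ⟨⟨y, hy⟩, h, rfl⟩
    exact ⟨hy, h⟩
  · rintro ⟨h, h'⟩
    exact ⟨⟨x, h⟩, h', rfl⟩

open Classical in
theorem suppSub_step (S : BHomSystem R Ω) {M : Type u} [AddCommGroup M] [Module R M]
    (B : Submodule R M) (idx : Ω → Type w) (q : B →ₗ[R] (⨁ ω : Ω, (idx ω →₀ S.Δ ω)))
    (hq : Function.Surjective q) (s : Set Ω) (a : Ω) (ha : a ∉ s) (hne : Nonempty (idx a)) :
    suppSub S B idx q s < suppSub S B idx q (insert a s) ∧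
    SlimQ S (suppSub S B idx q s) (suppSub S B idx q (insert a s)) (idx a) a := by
  have hle : suppSub S B idx q (insert a s) ≤ B := by
    intro x hx
    exact ((mem_suppSub ..).1 hx).1
  have hle2 : suppSub S B idx q s ≤ suppSub S B idx q (insert a s) := by
    intro x hx
    obtain ⟨h, h'⟩ := (mem_suppSub ..).1 hx
    exact (mem_suppSub ..).2 ⟨h, fun ω hω => h' ω fun h => hω (Set.mem_insert_of_mem _ h)⟩
  let f : suppSub S B idx q (insert a s) →ₗ[R] (idx a →₀ S.Δ a) :=
    (DirectSum.component R Ω (fun ω => idx ω →₀ S.Δ ω) a) ∘ₗ q ∘ₗ Submodule.inclusion hle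
  have hf : ∀ x, f x = q ⟨x.1, hle x.2⟩ a := fun x => rfl
  have hsurj : Function.Surjective f := by
    intro y
    obtain ⟨x, hx⟩ := hq (DirectSum.lof R Ω (fun ω => idx ω →₀ S.Δ ω) a y)
    have hx' : x.1 ∈ suppSub S B idx q (insert a s) := by
      refine (mem_suppSub ..).2 ⟨x.2, fun ω hω => ?_⟩
      have : a ≠ ω := fun h => hω (h ▸ Set.mem_insert _ _)
      change q x ω = 0
      rw [hx, DirectSum.lof_eq_of]
      exact DirectSum.of_eq_of_ne _ _ _ this.symm
    refine ⟨⟨x.1, hx'⟩, ?_⟩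
    rw [hf]
    change q x a = y
    rw [hx, DirectSum.lof_eq_of]
    exact DirectSum.of_eq_same _ _
  have hker : LinearMap.ker f = Submodule.comap (suppSub S B idx q (insert a s)).subtype
      (suppSub S B idx q s) := by
    ext x
    rw [LinearMap.mem_ker, hf, Submodule.mem_comap]
    obtain ⟨h, h'⟩ := (mem_suppSub ..).1 x.2
    constructor
    · intro h0
      refine (mem_suppSub ..).2 ⟨h, fun ω hω => ?_⟩
      by_cases hωa : ω = a
      · subst hωa; exact h0
      · exact h' ω (by simp [hωa, hω])
    · intro h0
      obtain ⟨_, h2⟩ := (mem_suppSub ..).1 h0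
      exact h2 a ha
  refine ⟨lt_of_le_of_ne hle2 fun heq => ?_, ?_⟩
  · obtain ⟨i⟩ := hne
    have := S.localEnd a
    have hnt : Nontrivial (S.Δ a) := by
      by_contra hn
      rw [not_nontrivial_iff_subsingleton] at hn
      apply one_ne_zero (α := Module.End R (S.Δ a))
      ext z
      exact Subsingleton.elim _ _
    obtain ⟨z, hz⟩ := exists_ne (0 : S.Δ a)
    obtain ⟨x, hx⟩ := hsurj (Finsupp.single i z)
    have : x ∈ LinearMap.ker f := by
      rw [hker, Submodule.mem_comap]
      exact heq.symm.le x.2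
    rw [LinearMap.mem_ker, hx, Finsupp.single_eq_zero] at this
    exact hz this
  · exact ⟨(Submodule.quotEquivOfEq _ _ hker.symm).trans (f.quotKerEquivOfSurjective hsurj)⟩

open Classical in
theorem SlimPart.layer {S : BHomSystem R Ω} {M : Type u} [AddCommGroup M] [Module R M]
    {A B : Submodule R M} {m : Ω → Cardinal.{w}} {T : Set (Submodule R M)}
    (h : SlimPart S A m T) (hAT : A ∈ T) (hAB : A ≤ B) (idx : Ω → Type w)
    (hfin : {ω : Ω | Nonempty (idx ω)}.Finite)
    (e : (↥B ⧸ (Submodule.comap B.subtype A)) ≃ₗ[R] (⨁ ω : Ω, (idx ω →₀ S.Δ ω))) :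
    SlimPart S B (fun ω => m ω + Cardinal.mk (idx ω)) (insert B T) := by
  let q : B →ₗ[R] (⨁ ω : Ω, (idx ω →₀ S.Δ ω)) := e.toLinearMap ∘ₗ Submodule.mkQ _
  have hq : Function.Surjective q := e.surjective.comp (Submodule.mkQ_surjective _)
  have hq0 : ∀ x, q x = 0 ↔ x.1 ∈ A := by
    intro x
    change e _ = 0 ↔ _
    rw [e.map_eq_zero_iff, Submodule.mkQ_apply, Submodule.Quotient.mk_eq_zero]
    rfl
  have key : ∀ s : Finset Ω, (∀ ω ∈ s, Nonempty (idx ω)) →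
      SlimPart S (suppSub S B idx q (s : Set Ω))
        (fun ω => m ω + if ω ∈ s then Cardinal.mk (idx ω) else 0)
        (insert (suppSub S B idx q (s : Set Ω)) T) := by
    intro s
    induction s using Finset.induction_on with
    | empty =>
      intro _
      have : suppSub S B idx q ((∅ : Finset Ω) : Set Ω) = A := by
        ext x
        rw [mem_suppSub]
        constructor
        · rintro ⟨h1, h2⟩
          refine (hq0 ⟨x, h1⟩).1 (DFinsupp.ext fun ω => h2 ω (by simp))
        · intro hx
          refine ⟨hAB hx, fun ω _ => ?_⟩
          rw [(hq0 ⟨x, hAB hx⟩).2 hx, DirectSum.zero_apply]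
      rw [this, Set.insert_eq_of_mem hAT]
      simpa using h
    | insert a s ha ih =>
      intro hs
      have h1 := ih fun ω hω => hs ω (Finset.mem_insert_of_mem hω)
      obtain ⟨h2, h3⟩ := suppSub_step S B idx q hq (s : Set Ω) a (by simpa using ha)
        (hs a (Finset.mem_insert_self _ _))
      have h4 := (h1.step h2 h3).mono (Set.insert_subset_insert (Set.subset_insert _ T))
      rw [Finset.coe_insert]
      convert h4 using 2 with ω
      rw [add_assoc]
      congr 1
      by_cases hω : a = ω
      · subst hω; simp [ha]
      · have : ω ≠ a := fun h => hω h.symm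
        simp [hω, this]
  have h1 := key hfin.toFinset (by simp)
  have h2 : suppSub S B idx q (hfin.toFinset : Set Ω) = B := by
    ext x
    rw [mem_suppSub]
    refine ⟨fun h => h.1, fun h => ⟨h, fun ω hω => ?_⟩⟩
    have : IsEmpty (idx ω) := by simpa using hω
    exact Subsingleton.elim _ _
  rw [h2] at h1
  convert h1 using 3 with ω
  split_ifs with hω
  · rfl
  · have : IsEmpty (idx ω) := by simpa using hω
    simp

end Aux

/-- Every `Δ̃`-filtration `F` of `M` can be refined to a slim `Δ̃`-filtration containing all the
submodules of `F` and having the same multiplicities `ℓ_ω`. -/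
theorem exists_slim_refinement (S : BHomSystem R Ω) (M : Type u) [AddCommGroup M] [Module R M]
    (F : BHomSystem.TildeFiltration.{u, w} S M) :
    ∃ Fb : BHomSystem.SlimFiltration.{u, w} S M,
      (∀ i : Fin (F.len + 1), ∃ j : Fin (Fb.len + 1), F.W i = Fb.W j) ∧
      ∀ ω : Ω, F.mult ω = Fb.mult ω := by
  classical
  have key : ∀ k : Fin (F.len + 1), SlimPart S (F.W k)
      (fun ω => ∑ i : Fin F.len, if i.castSucc < k then Cardinal.mk (F.idx i ω) else 0)
      (F.W '' Set.Iic k) := by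
    intro k
    induction k using Fin.induction with
    | zero =>
      rw [F.bot]
      have h0 := SlimPart.zero.{u, w} S (M := M)
      have hs : F.W '' Set.Iic 0 ⊆ {⊥} := by
        rintro X ⟨j, hj, rfl⟩
        have : j = 0 := Fin.le_zero_iff.1 hj
        rw [this, F.bot]; rfl
      simpa using h0.mono hs
    | succ k ih =>
      obtain ⟨e⟩ := F.iso k
      have h1 := ih.layer ⟨_, Set.mem_Iic.2 le_rfl, rfl⟩
        (F.strictMono.monotone (Fin.castSucc_lt_succ (i := k)).le) (F.idx k) (F.finSupp k) e
      have hs : F.W '' Set.Iic k.succ ⊆ insert (F.W k.succ) (F.W '' Set.Iic k.castSucc) := by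
        rintro X ⟨j, hj, rfl⟩
        rcases (Set.mem_Iic.1 hj).eq_or_lt with rfl | hlt
        · exact Or.inl rfl
        · exact Or.inr ⟨j, Fin.le_castSucc_iff.2 hlt, rfl⟩
      convert h1.mono hs using 2 with ω
      have : ∀ i : Fin F.len, (if i.castSucc < k.succ then Cardinal.mk (F.idx i ω) else 0) =
          (if i.castSucc < k.castSucc then Cardinal.mk (F.idx i ω) else 0) +
          (if i = k then Cardinal.mk (F.idx i ω) else 0) := by
        intro i
        simp only [Fin.castSucc_lt_succ_iff, Fin.castSucc_lt_castSucc_iff]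
        rcases lt_trichotomy i k with h | h | h
        · simp [h, h.le, h.ne]
        · simp [h]
        · simp [h.not_ge, h.not_gt, h.ne']
      rw [Finset.sum_congr rfl fun i _ => this i, Finset.sum_add_distrib]
      simp
  obtain ⟨n, W, lay, idx, h1, h2, h3, h4, h5, h6⟩ := key (Fin.last _)
  refine ⟨⟨n, W, h1, h2, h3.trans F.top, lay, idx, h4⟩, fun i => ?_, fun ω => ?_⟩
  · obtain ⟨j, hj⟩ := h6 ⟨i, Fin.le_last i, rfl⟩
    exact ⟨j, hj.symm⟩
  · have := h5 ω
    simp only [Fin.castSucc_lt_last, if_true] at this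
    exact this
end

section
/- Let (Δ; Ω, ≤) be a b-homological system over R, ⪯ a fixed linear order on Ω/∼ extending the induced partial order, and let 0 = W_{u_{a+1}} ⊊ W_{u_a} ⊊ ⋯ ⊊ W_{u_1} = M be an ordered Δ̃-filtration of a nonzero left R-module M. Then the bottom layer W_{u_a} equals its own trace in M: W_{u_a} = tr_{W_{u_a}}(M), the sum of the images of all R-module homomorphisms W_{u_a} → M. -/
open CategoryTheory DirectSum

universe u v w

variable {R : Type u} [Ring R] {Ω : Type u} [Preorder Ω]

theorem BHomSystem.hom_zero_aux (S : BHomSystem R Ω)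
    (x y : Antisymmetrization Ω (· ≤ ·)) (hxy : ¬ x ≤ y) (I J : Ω → Type w)
    (g : (⨁ ω : {ω : Ω // ordCls ω = x}, (I ω.1 →₀ S.Δ ω.1)) →ₗ[R]
      (⨁ ω : {ω : Ω // ordCls ω = y}, (J ω.1 →₀ S.Δ ω.1))) : g = 0 := by
  classical
  refine DirectSum.linearMap_ext R fun ω => ?_
  refine Finsupp.lhom_ext' fun i => ?_
  refine LinearMap.ext fun m => ?_
  refine DFinsupp.ext fun ω' => ?_
  refine Finsupp.ext fun j => ?_
  by_contra hne
  apply hxy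
  have h := S.hs3 (ω := ω.1) (ω' := ω'.1)
    ⟨(Finsupp.lapply j) ∘ₗ (DirectSum.component R {ω : Ω // ordCls ω = y}
        (fun ω : {ω : Ω // ordCls ω = y} => (J ω.1 →₀ S.Δ ω.1)) ω') ∘ₗ g ∘ₗ
      (DirectSum.lof R _ (fun ω : {ω : Ω // ordCls ω = x} => (I ω.1 →₀ S.Δ ω.1)) ω) ∘ₗ
      (Finsupp.lsingle i), fun h0 => hne (LinearMap.congr_fun h0 m)⟩
  rw [← ω.2, ← ω'.2]
  exact h

/-- The bottom layer `W_{u_a}` of an ordered `Δ̃`-filtration of a nonzero module `M` equals its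
own trace in `M`, the sum of the images of all homomorphisms `W_{u_a} → M`. -/
theorem bottom_layer_eq_trace (S : BHomSystem R Ω)
    (r : Antisymmetrization Ω (· ≤ ·) → Antisymmetrization Ω (· ≤ ·) → Prop)
    (hr : IsLinearOrder (Antisymmetrization Ω (· ≤ ·)) r)
    (hext : ∀ x y : Antisymmetrization Ω (· ≤ ·), x ≤ y → r x y)
    (M : Type u) [AddCommGroup M] [Module R M] [Nontrivial M]
    (F : BHomSystem.OrderedFiltration.{u, w} S r M) :
    F.W ⟨F.a - 1, by omega⟩ =
      ⨆ f : ↥(F.W ⟨F.a - 1, by omega⟩) →ₗ[R] M, LinearMap.range f := by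
  have ha : F.a ≠ 0 := by
    intro h0
    have h1 : (0 : Fin (F.a + 1)) = Fin.last F.a := by
      apply Fin.ext; simp [h0]
    have h2 := F.top
    rw [h1, F.bot] at h2
    exact bot_ne_top h2
  apply le_antisymm
  · refine le_trans ?_ (le_iSup _ (F.W ⟨F.a - 1, by omega⟩).subtype)
    rw [Submodule.range_subtype]
  refine iSup_le fun f => ?_
  let t : Fin F.a := ⟨F.a - 1, by omega⟩
  have htb : F.W t.succ = ⊥ := by
    rw [← F.bot]; congr 1; apply Fin.ext; simp [t]; omega
  obtain ⟨e⟩ := F.iso t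
  have hb : Submodule.comap (F.W t.castSucc).subtype (F.W t.succ) = ⊥ := by
    rw [htb]; exact Submodule.ker_subtype _
  let e' := e.symm.trans (Submodule.quotEquivOfEqBot _ hb)
  have key : ∀ n : ℕ, ∀ hn : n ≤ F.a - 1,
      LinearMap.range f ≤ F.W ⟨n, by omega⟩ := by
    intro n
    induction n with
    | zero =>
      intro _
      have : F.W ⟨0, by omega⟩ = ⊤ := F.top
      rw [this]; exact le_top
    | succ n ih =>
      intro hn
      have ih' := ih (by omega)
      let s : Fin F.a := ⟨n, by omega⟩
      obtain ⟨es⟩ := F.iso s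
      have hst : s < t := by
        change n < F.a - 1
        omega
      have hns : ¬ F.u t ≤ F.u s := fun hle =>
        (F.uStrictMono hst).2 (hr.antisymm _ _ (F.uStrictMono hst).1 (hext _ _ hle))
      let f' : ↥(F.W t.castSucc) →ₗ[R] ↥(F.W s.castSucc) :=
        LinearMap.codRestrict (F.W s.castSucc) f (fun x => ih' (LinearMap.mem_range_self f x))
      have hz := S.hom_zero_aux (F.u t) (F.u s) hns (F.idx t) (F.idx s)
        (es.toLinearMap ∘ₗ (Submodule.mkQ _) ∘ₗ f' ∘ₗ e'.toLinearMap)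
      rintro _ ⟨x, rfl⟩
      have hx := LinearMap.congr_fun hz (e'.symm x)
      have hx2 : es (Submodule.Quotient.mk (f' (e' (e'.symm x)))) = 0 := hx
      rw [e'.apply_symm_apply, LinearEquiv.map_eq_zero_iff, Submodule.Quotient.mk_eq_zero] at hx2
      exact hx2
  exact key _ le_rfl
end
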